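/- arXiv:1408.5494 — 3 statements merged into one kernel-verified Lean document; each statement's English description precedes it below -/
import Mathlib

section
/- Let n₁ ≥ 1 and K = 0, let (λ₁,…,λ_{n₁}, μ₁,…,μ_{n₁}) be a real-analytic solution of the system (ODE) on an open interval I with τ not identically zero, and suppose there are real-analytic functions φ, ψ on I with μᵢ = φλᵢ + ψ for all i. Then ψ(t) ≠ 0 for every t ∈ I. -/
open Filter Topology

lemma alg {ι : Type*} [DecidableEq ι] (T : Finset ι) (d : ι → ℝ) (i0 : ι) (hi0 : i0 ∈ T) (hd : d i0 = 0)
    (k : ℝ) (hk : k ≠ 0) (y0 : ℝ) (hy0 : ∀ i ∈ T, y0 + d i ≠ 0)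
    (h : ∃ᶠ y in 𝓝[≠] y0, (∀ i ∈ T, y + d i ≠ 0) ∧
      k^2 * (6 * (∑ i ∈ T, (1/(y + d i))) * (∑ i ∈ T, (1/(y + d i))^2)
        + 9 * ∑ i ∈ T, (1/(y + d i))^3)^3
      = (∏ i ∈ T, (y + d i))^2 * (9 * ∑ i ∈ T, (1/(y + d i))^3 - (∑ i ∈ T, (1/(y + d i)))^3)^3) :
    False := by
  let r : ι → ℂ → ℂ := fun i z => if d i = 0 then 1 else z / (z + d i)
  let s : ℕ → ℂ → ℂ := fun j z => ∑ i ∈ T, (r i z)^j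
  let G : ℂ → ℂ := fun z => (k:ℂ)^2 * (6 * s 1 z * s 2 z + 9 * s 3 z)^3
    - (∏ i ∈ T, (z + d i))^2 * (9 * s 3 z - (s 1 z)^3)^3
  let B : Set ℂ := ((T.filter (fun i => d i ≠ 0)).image (fun i => -(d i : ℂ)) : Finset ℂ)
  have hB : ∀ z ∈ Bᶜ, ∀ i ∈ T, d i ≠ 0 → z + d i ≠ 0 := by
    intro z hz i hi hdi h0
    apply hz
    simp only [B, Finset.coe_image, Set.mem_image, Finset.coe_filter, Set.mem_ofPred_eq]
    exact ⟨i, ⟨hi, hdi⟩, by linear_combination -h0⟩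
  have hB2 : ∀ z : ℂ, (∀ i ∈ T, d i ≠ 0 → z + d i ≠ 0) → z ∈ Bᶜ := by
    rintro z hz hzB
    simp only [B, Finset.coe_image, Set.mem_image, Finset.coe_filter, Set.mem_ofPred_eq] at hzB
    obtain ⟨i, ⟨hi, hdi⟩, e⟩ := hzB
    exact hz i hi hdi (by rw [← e]; ring)
  have hr : ∀ i ∈ T, AnalyticOnNhd ℂ (r i) Bᶜ := by
    intro i hi z hz
    by_cases h0 : d i = 0
    · simp only [r, h0, if_true]; exact analyticAt_const
    · simp only [r, h0, if_false]
      exact analyticAt_id.fun_div (analyticAt_id.fun_add analyticAt_const) (hB z hz i hi h0)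
  have hs : ∀ j, AnalyticOnNhd ℂ (s j) Bᶜ := by
    intro j z hz
    exact Finset.analyticAt_fun_sum _ (fun i hi => (hr i hi z hz).fun_pow j)
  have hG : AnalyticOnNhd ℂ G Bᶜ := by
    intro z hz
    have h1 := hs 1 z hz
    have h2 := hs 2 z hz
    have h3 := hs 3 z hz
    have hP : AnalyticAt ℂ (fun z : ℂ => ∏ i ∈ T, (z + (d i:ℂ))) z :=
      Finset.analyticAt_fun_prod _ (fun i hi => analyticAt_id.fun_add analyticAt_const)
    simp only [G]
    fun_prop
  have hconn : IsPreconnected Bᶜ := by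
    apply IsConnected.isPreconnected
    apply Set.Countable.isConnected_compl_of_one_lt_rank
    · rw [Complex.rank_real_complex]; norm_num
    · exact (Finset.finite_toSet _).countable
  have hy0B : (y0 : ℂ) ∈ Bᶜ := hB2 _ (fun i hi _ => by exact_mod_cast hy0 i hi)
  have h0B : (0 : ℂ) ∈ Bᶜ := hB2 _ (fun i hi h0 => by simpa using h0)
  have hreal : ∀ y : ℝ, ((∀ i ∈ T, y + d i ≠ 0) ∧
      k^2 * (6 * (∑ i ∈ T, (1/(y + d i))) * (∑ i ∈ T, (1/(y + d i))^2)
        + 9 * ∑ i ∈ T, (1/(y + d i))^3)^3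
      = (∏ i ∈ T, (y + d i))^2 * (9 * ∑ i ∈ T, (1/(y + d i))^3 - (∑ i ∈ T, (1/(y + d i)))^3)^3) →
      G (y : ℂ) = 0 := by
    rintro y ⟨hy, e⟩
    have hsj : ∀ j, s j (y:ℂ) = (y:ℂ)^j * ((∑ i ∈ T, (1/(y + d i))^j : ℝ) : ℂ) := by
      intro j
      simp only [s]
      push_cast
      rw [Finset.mul_sum]
      refine Finset.sum_congr rfl fun i hi => ?_
      rw [← mul_pow]
      congr 1
      have := hy i hi
      by_cases h0 : d i = 0
      · have hyy : (y:ℂ) ≠ 0 := by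
          rw [h0] at this; simpa using this
        simp [r, h0, hyy]
      · simp only [r, h0, if_false]; ring
    have e' := congrArg (fun x : ℝ => (x : ℂ)) e
    simp only [Complex.ofReal_mul, Complex.ofReal_add, Complex.ofReal_pow, Complex.ofReal_sub, Complex.ofReal_ofNat] at e'
    simp only [G, hsj]
    have hP : (∏ i ∈ T, ((y:ℂ) + (d i:ℂ))) = ((∏ i ∈ T, (y + d i) : ℝ) : ℂ) := by push_cast; rfl
    rw [hP]
    simp only [pow_one]
    linear_combination (y:ℂ)^9 * e'
  have htend : Tendsto (fun y : ℝ => (y:ℂ)) (𝓝[≠] y0) (𝓝[≠] (y0:ℂ)) := by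
    refine tendsto_nhdsWithin_of_tendsto_nhds_of_eventually_within _ ?_ ?_
    · exact (Complex.continuous_ofReal.tendsto y0).mono_left nhdsWithin_le_nhds
    · filter_upwards [self_mem_nhdsWithin] with y hy
      simpa using hy
  have hfreq : ∃ᶠ z in 𝓝[≠] (y0:ℂ), G z = 0 := htend.frequently (h.mono hreal)
  have hz := hG.eqOn_zero_of_preconnected_of_frequently_eq_zero hconn hy0B hfreq h0B
  have hP0 : (∏ i ∈ T, ((0:ℂ) + (d i:ℂ))) = 0 := Finset.prod_eq_zero hi0 (by simp [hd])
  have hs0 : ∀ j, j ≠ 0 → s j 0 = ((T.filter (fun i => d i = 0)).card : ℂ) := by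
    intro j hj
    simp only [s, r]
    rw [Finset.card_eq_sum_ones, Finset.sum_filter]
    push_cast
    refine Finset.sum_congr rfl fun i hi => ?_
    by_cases h0 : d i = 0 <;> simp [h0, hj]
  simp only [G, hP0, Pi.zero_apply, hs0 1 (by norm_num), hs0 2 (by norm_num), hs0 3 (by norm_num)] at hz
  have hm : 0 < (T.filter (fun i => d i = 0)).card := Finset.card_pos.mpr ⟨i0, by simp [hi0, hd]⟩
  set m := (T.filter (fun i => d i = 0)).card
  have : (k:ℂ)^2 * (6 * m * m + 9 * m)^3 = 0 := by linear_combination hz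
  have h2 : k^2 * (6 * (m:ℝ) * m + 9 * m)^3 = 0 := by exact_mod_cast this
  have hm' : (0:ℝ) < m := by exact_mod_cast hm
  have : 0 < k^2 * (6 * (m:ℝ) * m + 9 * m)^3 := by positivity
  linarith

lemma const_of (a b : ℝ) (f : ℝ → ℝ) (hf : ∀ t ∈ Set.Ioo a b, HasDerivAt f 0 t) :
    ∀ x ∈ Set.Ioo a b, ∀ y ∈ Set.Ioo a b, f x = f y := by
  intro x hx y hy
  exact isOpen_Ioo.is_const_of_deriv_eq_zero isPreconnected_Ioo
    (fun t ht => (hf t ht).differentiableAt.differentiableWithinAt)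
    (fun t ht => (hf t ht).deriv) hx hy

lemma equal_case (N : ℝ) (hN : 0 < N) (a b : ℝ) (hab : a < b) (l m tau : ℝ → ℝ)
    (htau : ∀ t ∈ Set.Ioo a b, tau t = (2/3) * (N * l t))
    (hl : ∀ t ∈ Set.Ioo a b, HasDerivAt l ((tau t / 2 + l t) * m t) t)
    (hm : ∀ t ∈ Set.Ioo a b, HasDerivAt m ((m t)^2 - tau t / 2 * l t) t)
    (h3 : ∀ t ∈ Set.Ioo a b, -(deriv (deriv tau) t) + deriv tau t * (N * m t)
        + tau t * ((tau t) ^ 2 / 4 + N * (l t) ^ 2) = 0)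
    (hne : ∀ t ∈ Set.Ioo a b, tau t ≠ 0) : False := by
  have hl' : ∀ t ∈ Set.Ioo a b, HasDerivAt l ((N/3+1) * (l t * m t)) t := by
    intro t ht
    refine HasDerivAt.congr_deriv (hl t ht) (Eq.symm ?_)
    rw [htau t ht]; ring
  have hm' : ∀ t ∈ Set.Ioo a b, HasDerivAt m ((m t)^2 - N/3 * (l t)^2) t := by
    intro t ht
    refine HasDerivAt.congr_deriv (hm t ht) (Eq.symm ?_)
    rw [htau t ht]; ring
  have hd1 : ∀ t ∈ Set.Ioo a b, deriv tau t = (2/3) * (N * ((N/3+1) * (l t * m t))) := by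
    intro t ht
    have : tau =ᶠ[𝓝 t] fun t => (2/3) * (N * l t) := by
      filter_upwards [isOpen_Ioo.mem_nhds ht] with s hs using htau s hs
    rw [this.deriv_eq]
    exact (((hl' t ht).const_mul N).const_mul (2/3)).deriv
  have hd2 : ∀ t ∈ Set.Ioo a b, deriv (deriv tau) t = (2/3) * (N * ((N/3+1) *
      ((N/3+1) * (l t * m t) * m t + l t * ((m t)^2 - N/3 * (l t)^2)))) := by
    intro t ht
    have : deriv tau =ᶠ[𝓝 t] fun t => (2/3) * (N * ((N/3+1) * (l t * m t))) := by
      filter_upwards [isOpen_Ioo.mem_nhds ht] with s hs using hd1 s hs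
    rw [this.deriv_eq]
    exact (((((hl' t ht).fun_mul (hm' t ht)).const_mul (N/3+1)).const_mul N).const_mul (2/3)).deriv
  have hlne : ∀ t ∈ Set.Ioo a b, l t ≠ 0 := by
    intro t ht h0
    apply hne t ht; rw [htau t ht, h0]; ring
  have key : ∀ t ∈ Set.Ioo a b, (N+3)*(N-3) * (m t)^2 + N*(N+6) * (l t)^2 = 0 := by
    intro t ht
    have e := h3 t ht
    rw [hd2 t ht, hd1 t ht, htau t ht] at e
    have : (N * l t) * ((N+3)*(N-3) * (m t)^2 + N*(N+6) * (l t)^2) = 0 := by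
      linear_combination (27/4) * e
    exact (mul_eq_zero.mp this).resolve_left (mul_ne_zero hN.ne' (hlne t ht))
  have ht : (a+b)/2 ∈ Set.Ioo a b := ⟨by linarith, by linarith⟩
  set t := (a+b)/2
  have hD := (((hm' t ht).fun_pow 2).const_mul ((N+3)*(N-3))).fun_add
    (((hl' t ht).fun_pow 2).const_mul (N*(N+6)))
  have hZ : (fun t => (N+3)*(N-3) * (m t)^2 + N*(N+6) * (l t)^2) =ᶠ[𝓝 t] fun _ => 0 := by
    filter_upwards [isOpen_Ioo.mem_nhds ht] with s hs using key s hs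
  have h0 := hD.unique ((hasDerivAt_const t (0:ℝ)).congr_of_eventuallyEq hZ)
  have k := key t ht
  push_cast at h0
  have hmz : m t * ((l t)^2 * (N/3 * (6*N+9))) = 0 := by
    linear_combination (1/2) * h0 - m t * k
  have hl0 := hlne t ht
  have hm0 : m t = 0 := (mul_eq_zero.mp hmz).resolve_right (by positivity)
  rw [hm0] at k
  have : 0 < N*(N+6) * (l t)^2 := by positivity
  nlinarith

lemma core {n : ℕ} (a b : ℝ) (hab : a < b) (lam : Fin n → ℝ → ℝ) (tau phi : ℝ → ℝ)
    (htau : ∀ t, tau t = (2/3) * ∑ i, lam i t)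
    (hl : ∀ i, ∀ t ∈ Set.Ioo a b, HasDerivAt (lam i) ((tau t / 2 + lam i t) * (phi t * lam i t)) t)
    (hphi : ∀ t ∈ Set.Ioo a b, HasDerivAt phi (-(1 + phi t ^ 2) * tau t / 2) t)
    (h3 : ∀ t ∈ Set.Ioo a b, -(deriv (deriv tau) t) + deriv tau t * (∑ i, phi t * lam i t)
        + tau t * ((tau t) ^ 2 / 4 + ∑ i, (lam i t) ^ 2) = 0)
    (hne : ∀ t ∈ Set.Ioo a b, tau t ≠ 0)
    (hdich : ∀ i, (∀ t ∈ Set.Ioo a b, lam i t = 0) ∨ (∀ t ∈ Set.Ioo a b, lam i t ≠ 0)) : False := by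
  classical
  have hp1 : ∀ t, ∑ i, lam i t = 3/2 * tau t := by intro t; rw [htau]; ring
  have htd : ∀ t ∈ Set.Ioo a b, HasDerivAt tau (phi t * (tau t ^2 / 2 + 2/3 * ∑ i, lam i t ^ 2)) t := by
    intro t ht
    have := (HasDerivAt.fun_sum (u := Finset.univ) (fun i _ => hl i t ht)).const_mul (2/3)
    have e : tau = fun y => (2/3) * ∑ i, lam i y := funext htau
    rw [← e] at this
    refine HasDerivAt.congr_deriv (this) (Eq.symm ?_)
    have : ∑ i, (tau t / 2 + lam i t) * (phi t * lam i t)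
        = tau t / 2 * phi t * ∑ i, lam i t + phi t * ∑ i, lam i t ^ 2 := by
      rw [Finset.mul_sum, Finset.mul_sum, ← Finset.sum_add_distrib]
      exact Finset.sum_congr rfl fun i _ => by ring
    rw [this, hp1]; ring
  have hSd : ∀ t ∈ Set.Ioo a b, HasDerivAt (fun t => ∑ i, lam i t ^ 2)
      (phi t * (tau t * ∑ i, lam i t ^ 2 + 2 * ∑ i, lam i t ^ 3)) t := by
    intro t ht
    have := (HasDerivAt.fun_sum (u := Finset.univ) (fun i _ => (hl i t ht).fun_pow 2))
    refine HasDerivAt.congr_deriv (this) (Eq.symm ?_)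
    rw [Finset.mul_sum, Finset.mul_sum, ← Finset.sum_add_distrib, Finset.mul_sum]
    exact Finset.sum_congr rfl fun i _ => by push_cast; ring
  have rel : ∀ t ∈ Set.Ioo a b, tau t ^ 3 / 2 + 4/3 * tau t * ∑ i, lam i t ^ 2
      + phi t ^ 2 * (tau t ^ 3 / 2 - 4/3 * ∑ i, lam i t ^ 3) = 0 := by
    intro t ht
    have hev : deriv tau =ᶠ[𝓝 t] fun t => phi t * (tau t ^2 / 2 + 2/3 * ∑ i, lam i t ^ 2) := by
      filter_upwards [isOpen_Ioo.mem_nhds ht] with s hs using (htd s hs).deriv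
    have e := h3 t ht
    rw [hev.deriv_eq, ((hphi t ht).fun_mul ((((htd t ht).fun_pow 2).div_const 2).fun_add
      ((hSd t ht).const_mul (2/3)))).deriv, (htd t ht).deriv, ← Finset.mul_sum, hp1] at e
    push_cast at e
    linear_combination e
  have hphine : ∀ t ∈ Set.Ioo a b, phi t ≠ 0 := by
    intro t ht h0
    have e := rel t ht
    rw [h0] at e
    have hS : 0 ≤ ∑ i, lam i t ^ 2 := Finset.sum_nonneg fun i _ => sq_nonneg _
    have h1 : tau t * (tau t ^ 2 / 2 + 4/3 * ∑ i, lam i t ^ 2) = 0 := by linear_combination e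
    have h2 := (mul_eq_zero.mp h1).resolve_left (hne t ht)
    have : 0 < tau t ^ 2 := by have := hne t ht; positivity
    linarith
  let T : Finset (Fin n) := Finset.univ.filter (fun i => ∀ t ∈ Set.Ioo a b, lam i t ≠ 0)
  have hT : ∀ i ∈ T, ∀ t ∈ Set.Ioo a b, lam i t ≠ 0 := fun i hi => (Finset.mem_filter.mp hi).2
  have hTn : ∀ i, i ∉ T → ∀ t ∈ Set.Ioo a b, lam i t = 0 := by
    intro i hi
    rcases hdich i with h | h
    · exact h
    · exact absurd (Finset.mem_filter.mpr ⟨Finset.mem_univ i, h⟩) hi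
  have hsum : ∀ k : ℕ, k ≠ 0 → ∀ t ∈ Set.Ioo a b, ∑ i, lam i t ^ k = ∑ i ∈ T, lam i t ^ k := by
    intro k hk t ht
    symm
    apply Finset.sum_subset (Finset.subset_univ T)
    intro i _ hi
    rw [hTn i hi t ht, zero_pow hk]
  have ht1 : (a+b)/2 ∈ Set.Ioo a b := ⟨by linarith, by linarith⟩
  set t1 := (a+b)/2
  have hTne : T.Nonempty := by
    by_contra h
    rw [Finset.not_nonempty_iff_eq_empty] at h
    have := hsum 1 one_ne_zero t1 ht1
    rw [h] at this
    simp only [pow_one, Finset.sum_empty] at this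
    apply hne t1 ht1
    rw [htau, this, mul_zero]
  obtain ⟨i0, hi0⟩ := hTne
  let A : ℝ → ℝ := fun t => (Real.sqrt (1 + phi t ^ 2))⁻¹
  have hpos : ∀ t, 0 < 1 + phi t ^ 2 := fun t => by positivity
  have hApos : ∀ t, 0 < A t := fun t => by
    have := Real.sqrt_pos.mpr (hpos t)
    simp only [A]; positivity
  have hA2 : ∀ t, A t ^ 2 * (1 + phi t ^ 2) = 1 := by
    intro t
    simp only [A]
    rw [inv_pow, Real.sq_sqrt (hpos t).le]
    exact inv_mul_cancel₀ (hpos t).ne'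
  have hAd : ∀ t ∈ Set.Ioo a b, HasDerivAt A (phi t * tau t / 2 * A t) t := by
    intro t ht
    have hs := Real.sqrt_pos.mpr (hpos t)
    have := ((((hphi t ht).fun_pow 2).const_add 1).sqrt (hpos t).ne').fun_inv hs.ne'
    refine HasDerivAt.congr_deriv (this) (Eq.symm ?_)
    have hq := Real.sq_sqrt (hpos t).le
    simp only [A]
    push_cast
    set q := Real.sqrt (1 + phi t ^ 2)
    rw [← hq]
    field_simp
  let y : Fin n → ℝ → ℝ := fun i t => A t / lam i t
  have hyd : ∀ i ∈ T, ∀ t ∈ Set.Ioo a b, HasDerivAt (y i) (-(phi t * A t)) t := by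
    intro i hi t ht
    have hli := hT i hi t ht
    refine HasDerivAt.congr_deriv ((hAd t ht).fun_div (hl i t ht) hli) (Eq.symm ?_)
    field_simp
    ring
  have hyne : ∀ i ∈ T, ∀ t ∈ Set.Ioo a b, y i t ≠ 0 := fun i hi t ht =>
    div_ne_zero (hApos t).ne' (hT i hi t ht)
  let d : Fin n → ℝ := fun i => y i t1 - y i0 t1
  have hyi : ∀ i ∈ T, ∀ t ∈ Set.Ioo a b, y i0 t + d i = y i t := by
    intro i hi t ht
    have := const_of a b (fun t => y i t - y i0 t) (fun t ht => by
      simpa using (hyd i hi t ht).fun_sub (hyd i0 hi0 t ht)) t ht t1 ht1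
    simp only [d]
    linarith
  let P : ℝ → ℝ := fun t => A t ^ 3 * ∏ i ∈ T, y i t
  have hPc : ∀ t ∈ Set.Ioo a b, P t = P t1 := by
    intro t ht
    refine const_of a b P (fun t ht => ?_) t ht t1 ht1
    refine HasDerivAt.congr_deriv (((hAd t ht).fun_pow 3).fun_mul (HasDerivAt.fun_finsetProd (fun i hi => hyd i hi t ht))) (Eq.symm ?_)
    have e1 : ∑ i ∈ T, (∏ j ∈ T.erase i, y j t) • (-(phi t * A t))
        = -(phi t) * (∏ j ∈ T, y j t) * ∑ i ∈ T, lam i t := by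
      rw [Finset.mul_sum]
      refine Finset.sum_congr rfl fun i hi => ?_
      rw [← Finset.mul_prod_erase T _ hi, smul_eq_mul]
      have hli := hT i hi t ht
      simp only [y]
      field_simp
    have e2 := hsum 1 one_ne_zero t ht
    simp only [pow_one] at e2
    rw [e1, ← e2, hp1]
    push_cast
    ring
  have hPne : P t1 ≠ 0 := mul_ne_zero (pow_ne_zero _ (hApos t1).ne')
    (Finset.prod_ne_zero_iff.mpr fun i hi => hyne i hi t1 ht1)
  refine alg T d i0 hi0 (by simp [d]) (P t1) hPne (y i0 t1)
    (fun i hi => by rw [hyi i hi t1 ht1]; exact hyne i hi t1 ht1) ?_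
  have htend := (hyd i0 hi0 t1 ht1).tendsto_nhdsNE
    (neg_ne_zero.mpr (mul_ne_zero (hphine t1 ht1) (hApos t1).ne'))
  refine htend.frequently (Eventually.frequently ?_)
  filter_upwards [mem_nhdsWithin_of_mem_nhds (isOpen_Ioo.mem_nhds ht1)] with t ht
  refine ⟨fun i hi => by rw [hyi i hi t ht]; exact hyne i hi t ht, ?_⟩
  have hs : ∀ k, ∑ i ∈ T, (1 / (y i0 t + d i)) ^ k = ∑ i ∈ T, (1 / y i t) ^ k := fun k =>
    Finset.sum_congr rfl fun i hi => by rw [hyi i hi t ht]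
  have hs1 : ∑ i ∈ T, (1 / (y i0 t + d i)) = ∑ i ∈ T, (1 / y i t) := 
    Finset.sum_congr rfl fun i hi => by rw [hyi i hi t ht]
  rw [hs, hs, hs1, Finset.prod_congr rfl (fun i hi => hyi i hi t ht), ← hPc t ht]
  have hsl : ∀ k : ℕ, k ≠ 0 → ∑ i, lam i t ^ k = A t ^ k * ∑ i ∈ T, (1 / y i t) ^ k := by
    intro k hk
    rw [hsum k hk t ht, Finset.mul_sum]
    refine Finset.sum_congr rfl fun i hi => ?_
    rw [← mul_pow]
    congr 1
    have hli := hT i hi t ht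
    have := (hApos t).ne'
    simp only [y]
    field_simp
  have e1 := hsl 1 one_ne_zero
  have e2 := hsl 2 two_ne_zero
  have e3 := hsl 3 three_ne_zero
  simp only [pow_one] at e1
  have hr := rel t ht
  rw [e2, e3, htau, e1] at hr
  simp only [P]
  set s1 := ∑ i ∈ T, (1 / y i t)
  set s2 := ∑ i ∈ T, (1 / y i t) ^ 2
  set s3 := ∑ i ∈ T, (1 / y i t) ^ 3
  have hA := hA2 t
  have hAn := (hApos t).ne'
  have main : A t ^ 2 * (6 * s1 * s2 + 9 * s3) = 9 * s3 - s1 ^ 3 := by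
    have : A t ^ 3 * (A t ^ 2 * (6 * s1 * s2 + 9 * s3) - (9 * s3 - s1 ^ 3)) = 0 := by
      linear_combination (27/4) * A t ^ 2 * hr - A t ^ 3 * (s1 ^ 3 - 9 * s3) * hA
    have := (mul_eq_zero.mp this).resolve_left (pow_ne_zero 3 hAn)
    linarith
  rw [← main]
  ring

/-- Lemma (`psi ≠ 0`): `ψ` does not attain the value `0` on `I`. -/
theorem stmt_14 (n₁ : ℕ) (hn : 1 ≤ n₁) (K : ℝ) (hK : K = 0)
    (I : Set ℝ) (hI : IsOpen I) (hIconn : I.OrdConnected)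
    (lam mu : Fin n₁ → ℝ → ℝ)
    (hlam : ∀ i, AnalyticOnNhd ℝ (lam i) I)
    (hmu : ∀ i, AnalyticOnNhd ℝ (mu i) I)
    (tau : ℝ → ℝ) (htau : ∀ t, tau t = (2/3) * ∑ i, lam i t)
    (hode1 : ∀ i, ∀ t ∈ I, HasDerivAt (lam i) ((tau t / 2 + lam i t) * mu i t) t)
    (hode2 : ∀ i, ∀ t ∈ I,
      HasDerivAt (mu i) ((mu i t) ^ 2 - tau t / 2 * lam i t + K) t)
    (hode3 : ∀ t ∈ I,
      -(deriv (deriv tau) t) + deriv tau t * (∑ i, mu i t)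
        + tau t * ((tau t) ^ 2 / 4 - ((n₁ : ℝ) + 1) * K + ∑ i, (lam i t) ^ 2) = 0)
    (htau_ne : ¬ ∀ t ∈ I, tau t = 0)
    (phi psi : ℝ → ℝ)
    (hphi : AnalyticOnNhd ℝ phi I) (hpsi : AnalyticOnNhd ℝ psi I)
    (hlin : ∀ i, ∀ t ∈ I, mu i t = phi t * lam i t + psi t) :
    ∀ t ∈ I, psi t ≠ 0 := by
  intro t0 ht0 hpsi0
  subst hK
  have hIn : ∀ᶠ t in 𝓝 t0, t ∈ I := hI.mem_nhds ht0
  have htauA : AnalyticOnNhd ℝ tau I := by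
    intro t ht
    have e : tau = fun y => (2/3) * ∑ i, lam i y := funext htau
    rw [e]
    exact analyticAt_const.fun_mul (Finset.analyticAt_fun_sum _ fun i _ => hlam i t ht)
  have htn : ∀ᶠ t in 𝓝[≠] t0, tau t ≠ 0 := by
    rcases (htauA t0 ht0).eventually_eq_zero_or_eventually_ne_zero with h | h
    · exfalso
      apply htau_ne
      intro t ht
      exact htauA.eqOn_zero_of_preconnected_of_eventuallyEq_zero hIconn.isPreconnected ht0 h ht
    · exact h
  -- extraction of a right interval
  have hext : ∀ p : ℝ → Prop, (∀ᶠ t in 𝓝[≠] t0, p t) →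
      ∃ b, t0 < b ∧ ∀ t ∈ Set.Ioo t0 b, p t := by
    intro p hp
    have : ∀ᶠ t in 𝓝[>] t0, p t := hp.filter_mono (nhdsWithin_mono _ (fun x hx => ne_of_gt hx))
    obtain ⟨b, hb, h⟩ := mem_nhdsGT_iff_exists_Ioo_subset.mp this
    exact ⟨b, hb, fun t ht => h ht⟩
  by_cases heq : ∀ i j, ∀ᶠ t in 𝓝 t0, lam i t - lam j t = 0
  · have hall : ∀ᶠ t in 𝓝 t0, ∀ i j, lam i t - lam j t = 0 := by
      rw [eventually_all]; intro i; rw [eventually_all]; exact heq i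
    obtain ⟨b, hb, h⟩ := hext _ (htn.and ((hIn.and hall).filter_mono nhdsWithin_le_nhds))
    let i0 : Fin n₁ := ⟨0, hn⟩
    have hle : ∀ t ∈ Set.Ioo t0 b, ∀ i, lam i t = lam i0 t := fun t ht i =>
      sub_eq_zero.mp ((h t ht).2.2 i i0)
    have hIt : ∀ t ∈ Set.Ioo t0 b, t ∈ I := fun t ht => (h t ht).2.1
    have hme : ∀ t ∈ Set.Ioo t0 b, ∀ i, mu i t = mu i0 t := fun t ht i => by
      rw [hlin i t (hIt t ht), hlin i0 t (hIt t ht), hle t ht i]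
    refine equal_case (n₁ : ℝ) (by exact_mod_cast hn) t0 b hb (lam i0) (mu i0) tau ?_ ?_ ?_ ?_
      (fun t ht => (h t ht).1)
    · intro t ht
      rw [htau, Finset.sum_congr rfl (fun i _ => hle t ht i)]; simp
    · exact fun t ht => hode1 i0 t (hIt t ht)
    · intro t ht; simpa using hode2 i0 t (hIt t ht)
    · intro t ht
      have e := hode3 t (hIt t ht)
      rw [Finset.sum_congr rfl (fun i _ => hme t ht i),
        Finset.sum_congr rfl (fun i _ => by rw [hle t ht i] : ∀ i ∈ Finset.univ, lam i t ^ 2 = lam i0 t ^ 2)] at e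
      simpa using e
  · simp only [not_forall] at heq
    obtain ⟨i1, j1, hij⟩ := heq
    have hijne : ∀ᶠ t in 𝓝[≠] t0, lam i1 t - lam j1 t ≠ 0 :=
      (((hlam i1 t0 ht0).fun_sub (hlam j1 t0 ht0)).eventually_eq_zero_or_eventually_ne_zero).resolve_left
        (fun h => hij h)
    have hE : ∀ i, ∀ t ∈ I, (deriv phi t + phi t ^ 2 * tau t / 2 + tau t / 2 - phi t * psi t) * lam i t
        + (deriv psi t + phi t * psi t * tau t / 2 - psi t ^ 2) = 0 := by
      intro i t ht
      have e1 := hode2 i t ht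
      have e2 := (((hphi t ht).differentiableAt.hasDerivAt).fun_mul (hode1 i t ht)).fun_add
        (hpsi t ht).differentiableAt.hasDerivAt
      have e3 : mu i =ᶠ[𝓝 t] fun t => phi t * lam i t + psi t := by
        filter_upwards [hI.mem_nhds ht] with s hs using hlin i s hs
      have e4 := (e2.congr_of_eventuallyEq e3).unique e1
      rw [hlin i t ht] at e4
      linear_combination e4
    have hE1 : ∀ᶠ t in 𝓝 t0, deriv phi t + phi t ^ 2 * tau t / 2 + tau t / 2 - phi t * psi t = 0 := by
      have hA : AnalyticAt ℝ (fun t => deriv phi t + phi t ^ 2 * tau t / 2 + tau t / 2 - phi t * psi t) t0 := by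
        have := (hphi t0 ht0).deriv
        have := hphi t0 ht0
        have := hpsi t0 ht0
        have := htauA t0 ht0
        fun_prop (disch := norm_num)
      refine hA.eventually_eq_zero_or_eventually_ne_zero.resolve_right fun hc => ?_
      obtain ⟨t, h1, h2, h3⟩ := (hc.and (hijne.and (hIn.filter_mono nhdsWithin_le_nhds))).exists
      have := mul_ne_zero h1 h2
      apply this
      linear_combination hE i1 t h3 - hE j1 t h3
    have hE2 : ∀ᶠ t in 𝓝 t0, deriv psi t = (psi t - phi t * tau t / 2) * psi t := by
      filter_upwards [hE1, hIn] with t h1 h2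
      have := hE i1 t h2
      rw [h1] at this
      linear_combination this
    -- `psi` vanishes near `t0`
    have hpsiz : ∀ᶠ t in 𝓝 t0, psi t = 0 := by
      refine (hpsi t0 ht0).eventually_eq_zero_or_eventually_ne_zero.resolve_right fun hc => ?_
      have hcont : ContinuousAt (fun t => psi t - phi t * tau t / 2) t0 := by
        have := (hphi t0 ht0).continuousAt
        have := (hpsi t0 ht0).continuousAt
        have := (htauA t0 ht0).continuousAt
        fun_prop
      have hbd : ∀ᶠ t in 𝓝 t0, ‖psi t - phi t * tau t / 2‖ < ‖psi t0 - phi t0 * tau t0 / 2‖ + 1 :=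
        hcont.norm.eventually_lt continuousAt_const (by simp)
      obtain ⟨ε, hε, hball⟩ := Metric.eventually_nhds_iff.mp (hE2.and (hbd.and hIn))
      obtain ⟨b, hb, hcb⟩ := hext _ hc
      set c := min (t0 + ε/2) ((t0 + b)/2) with hcdef
      have hc1 : t0 < c := lt_min (by linarith) (by linarith)
      have hc2 : c < b := lt_of_le_of_lt (min_le_right _ _) (by linarith)
      have hc3 : c < t0 + ε := lt_of_le_of_lt (min_le_left _ _) (by linarith)
      have hin : ∀ t ∈ Set.Icc t0 c, dist t t0 < ε := by
        intro t ht
        rw [Real.dist_eq, abs_of_nonneg (by linarith [ht.1])]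
        linarith [ht.2]
      have := eq_zero_of_abs_deriv_le_mul_abs_self_of_eq_zero_right (f := psi) (f' := deriv psi)
        (K := ‖psi t0 - phi t0 * tau t0 / 2‖ + 1) (a := t0) (b := c)
        (fun t ht => (hpsi t (hball (hin t ht)).2.2).continuousAt.continuousWithinAt)
        (fun t ht => (hpsi t (hball (hin t (Set.Ico_subset_Icc_self ht))).2.2).differentiableAt.hasDerivAt.hasDerivWithinAt)
        hpsi0 (fun t ht => by
          have h := hball (hin t (Set.Ico_subset_Icc_self ht))
          rw [h.1, norm_mul]
          exact mul_le_mul_of_nonneg_right h.2.1.le (norm_nonneg _)) c ⟨hc1.le, le_rfl⟩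
      exact hcb c ⟨hc1, hc2⟩ this
    have hd : ∀ᶠ t in 𝓝[≠] t0, ∀ i, (∀ᶠ s in 𝓝 t0, lam i s = 0) ∧ lam i t = 0 ∨
        (¬ ∀ᶠ s in 𝓝 t0, lam i s = 0) ∧ lam i t ≠ 0 := by
      rw [eventually_all]
      intro i
      by_cases h : ∀ᶠ s in 𝓝 t0, lam i s = 0
      · filter_upwards [h.filter_mono nhdsWithin_le_nhds] with t ht using Or.inl ⟨h, ht⟩
      · filter_upwards [((hlam i t0 ht0).eventually_eq_zero_or_eventually_ne_zero).resolve_left h]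
          with t ht using Or.inr ⟨h, ht⟩
    obtain ⟨b, hb, h⟩ := hext _ (htn.and (hd.and ((hIn.and (hE1.and hpsiz)).filter_mono nhdsWithin_le_nhds)))
    have hIt : ∀ t ∈ Set.Ioo t0 b, t ∈ I := fun t ht => (h t ht).2.2.1
    have hmul : ∀ t ∈ Set.Ioo t0 b, ∀ i, mu i t = phi t * lam i t := fun t ht i => by
      rw [hlin i t (hIt t ht), (h t ht).2.2.2.2, add_zero]
    refine core t0 b hb lam tau phi htau ?_ ?_ ?_ (fun t ht => (h t ht).1) ?_
    · intro i t ht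
      rw [← hmul t ht i]
      exact hode1 i t (hIt t ht)
    · intro t ht
      have e := (h t ht).2.2.2.1
      rw [(h t ht).2.2.2.2] at e
      refine (hphi t (hIt t ht)).differentiableAt.hasDerivAt.congr_deriv ?_
      linear_combination e
    · intro t ht
      have e := hode3 t (hIt t ht)
      rw [Finset.sum_congr rfl (fun i _ => hmul t ht i)] at e
      linear_combination e
    · intro i
      by_cases hz : ∀ᶠ s in 𝓝 t0, lam i s = 0
      · left
        intro t ht
        rcases (h t ht).2.1 i with h' | h'
        · exact h'.2
        · exact absurd hz h'.1
      · right
        intro t ht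
        rcases (h t ht).2.1 i with h' | h'
        · exact absurd h'.1 hz
        · exact h'.2
end

section
/- Let n₁ ≥ 1 and K = 0, let (λ₁,…,λ_{n₁}, μ₁,…,μ_{n₁}) be a real-analytic solution of the system (ODE) on an open interval I with τ not identically zero, and suppose there are real-analytic functions φ, ψ on I with μᵢ = φλᵢ + ψ for all i. Then ψ is not a constant function on I. -/
open Polynomial in
theorem deg_ne (N D Q : ℝ[X]) (hN : N ≠ 0) (hD : D ≠ 0) (hQ : 1 ≤ Q.natDegree)
   (h : 3 * (derivative N * D - N * derivative D) * Q = 2 * N * D * derivative Q) :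
   N.natDegree ≠ D.natDegree := by
  intro e
  have hQ0 : Q ≠ 0 := by rintro rfl; simp at hQ
  have hQd : (derivative Q).natDegree = Q.natDegree - 1 := Polynomial.natDegree_derivative Q
  have hQ' : derivative Q ≠ 0 := by
    intro h0
    have := Polynomial.derivative_eq_zero.mp h0
    omega
  have h2 : (2:ℝ[X]) ≠ 0 := two_ne_zero
  have h3 : (3:ℝ[X]) ≠ 0 := by exact_mod_cast (three_ne_zero : (3:ℕ) ≠ 0)
  have hr : 2 * N * D * derivative Q ≠ 0 := by positivity
  set W := derivative N * D - N * derivative D with hW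
  have hW0 : W ≠ 0 := by
    intro h0; rw [h0] at h; apply hr; rw [← h]; simp
  have d1 : (2 * N * D * derivative Q).natDegree = N.natDegree + D.natDegree + (Q.natDegree - 1) := by
    rw [natDegree_mul (by positivity) hQ', natDegree_mul (by positivity) hD, natDegree_mul h2 hN, hQd]
    have : (2:ℝ[X]).natDegree = 0 := natDegree_ofNat 2
    omega
  have d2 : (3 * W * Q).natDegree = W.natDegree + Q.natDegree := by
    rw [natDegree_mul (by positivity) hQ0, natDegree_mul h3 hW0]
    have : (3:ℝ[X]).natDegree = 0 := natDegree_ofNat 3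
    omega
  rw [h, d1] at d2
  obtain ⟨c, hc⟩ : ∃ c : ℝ, c = N.leadingCoeff / D.leadingCoeff := ⟨_, rfl⟩
  have hlc : D.leadingCoeff ≠ 0 := leadingCoeff_ne_zero.mpr hD
  set M := N - C c * D with hM
  have hWM : W = - wronskian M D := by
    simp only [wronskian, hW, hM, derivative_sub, derivative_mul, derivative_C]; ring
  have hM0 : M.natDegree < D.natDegree ∨ M.natDegree = 0 := by
    by_cases hm : M.natDegree = 0
    · right; exact hm
    left
    have le : M.natDegree ≤ D.natDegree := by
      refine (natDegree_sub_le _ _).trans ?_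
      have := natDegree_C_mul_le c D
      simp; omega
    refine lt_of_le_of_ne le ?_
    intro h
    have : M.coeff M.natDegree = 0 := by
      rw [h, hM, coeff_sub, coeff_C_mul, ← e]
      have : D.coeff N.natDegree = D.leadingCoeff := by rw [e]; rfl
      rw [this, hc]
      have : N.coeff N.natDegree = N.leadingCoeff := rfl
      rw [this]; field_simp; simp
    rw [coeff_natDegree, leadingCoeff_eq_zero] at this
    rw [this] at hm; simp at hm
  have hw : wronskian M D ≠ 0 := by
    intro h0; rw [h0] at hWM; simp at hWM; exact hW0 hWM
  have := natDegree_wronskian_lt_add hw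
  rw [hWM, natDegree_neg] at d2
  rcases hM0 with hh | hh
  · omega
  · by_cases d0 : D.natDegree = 0
    · rw [hh, d0] at this; omega
    · omega

open Polynomial in
theorem poly_zero (p : ℝ[X]) (g : ℝ → ℝ) (g' t : ℝ) (U : Set ℝ) (hU : IsOpen U) (ht : t ∈ U)
    (hg : HasDerivAt g g' t) (hg' : g' ≠ 0) (h : ∀ x ∈ U, p.eval (g x) = 0) : p = 0 := by
  by_contra hp
  have h1 : ∀ᶠ z in nhdsWithin t {t}ᶜ, ∀ c ∈ p.roots.toFinset, g z ≠ c := by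
    rw [Filter.eventually_all_finset]
    intro c _
    exact hg.eventually_ne hg'
  have h2 : ∀ᶠ z in nhdsWithin t {t}ᶜ, z ∈ U := nhdsWithin_le_nhds (hU.mem_nhds ht)
  obtain ⟨z, hz1, hz2⟩ := (h1.and h2).exists
  exact hz1 (g z) (by simp [hp, h z hz2]) rfl

theorem shrink (f : ℝ → ℝ) (U : Set ℝ) (hU : IsOpen U) (hne : U.Nonempty) (hf : ContinuousOn f U) :
    ∃ V ⊆ U, IsOpen V ∧ V.Nonempty ∧ ((∀ t ∈ V, f t = 0) ∨ (∀ t ∈ V, f t ≠ 0)) := by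
  by_cases h : ∀ t ∈ U, f t = 0
  · exact ⟨U, subset_rfl, hU, hne, Or.inl h⟩
  · push Not at h
    obtain ⟨t, ht, h⟩ := h
    refine ⟨U ∩ f ⁻¹' {0}ᶜ, Set.inter_subset_left, hf.isOpen_inter_preimage hU isOpen_compl_singleton, ⟨t, ht, h⟩, Or.inr ?_⟩
    intro t ht; exact ht.2

theorem shrink_all {ι : Type*} (s : Finset ι) (f : ι → ℝ → ℝ) (U : Set ℝ) (hU : IsOpen U) (hne : U.Nonempty)
    (hf : ∀ i, ContinuousOn (f i) U) :
    ∃ V ⊆ U, IsOpen V ∧ V.Nonempty ∧ ∀ i ∈ s, ((∀ t ∈ V, f i t = 0) ∨ (∀ t ∈ V, f i t ≠ 0)) := by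
  classical
  induction s using Finset.induction_on with
  | empty => exact ⟨U, subset_rfl, hU, hne, by simp⟩
  | insert a s ha ih =>
    obtain ⟨V, hVU, hV, hVne, h⟩ := ih
    obtain ⟨V', hVU', hV', hVne', h'⟩ := shrink (f a) V hV hVne ((hf a).mono hVU)
    refine ⟨V', hVU'.trans hVU, hV', hVne', ?_⟩
    intro i hi
    rcases Finset.mem_insert.mp hi with rfl | hi
    · exact h'
    · rcases h i hi with h | h
      · exact Or.inl fun t ht => h t (hVU' ht)
      · exact Or.inr fun t ht => h t (hVU' ht)

/-- all `λᵢ` equal -/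
theorem case_eq (n : ℝ) (hn : 1 ≤ n) (l m tau : ℝ → ℝ) (U : Set ℝ) (hU : IsOpen U) (hne : U.Nonempty)
    (htau : ∀ t ∈ U, tau t = (2 * n / 3) * l t)
    (h1 : ∀ t ∈ U, HasDerivAt l ((n / 3 + 1) * l t * m t) t)
    (h2 : ∀ t ∈ U, HasDerivAt m (m t ^ 2 - n / 3 * l t ^ 2) t)
    (h3 : ∀ t ∈ U, -(deriv (deriv tau) t) + deriv tau t * (n * m t)
       + tau t * (tau t ^ 2 / 4 + n * l t ^ 2) = 0)
    (hl : ∀ t ∈ U, l t ≠ 0) : False := by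
  have nh : ∀ t ∈ U, ∀ᶠ z in nhds t, z ∈ U := fun t ht => hU.mem_nhds ht
  have d1 : ∀ t ∈ U, deriv tau t = (2 * n / 3) * ((n / 3 + 1) * l t * m t) := by
    intro t ht
    have : tau =ᶠ[nhds t] fun t => (2 * n / 3) * l t := (nh t ht).mono htau
    rw [this.deriv_eq]
    exact ((h1 t ht).const_mul _).deriv
  have d2 : ∀ t ∈ U, deriv (deriv tau) t = (2 * n / 3) * ((n / 3 + 1) * ((n / 3 + 1) * l t * m t) * m t + (n / 3 + 1) * l t * (m t ^ 2 - n / 3 * l t ^ 2)) := by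
    intro t ht
    have : deriv tau =ᶠ[nhds t] fun t => (2 * n / 3) * ((n / 3 + 1) * l t * m t) := (nh t ht).mono d1
    rw [this.deriv_eq]
    exact ((((h1 t ht).const_mul _).mul (h2 t ht)).const_mul _).deriv
  obtain ⟨b, hb⟩ : ∃ b, b = n / 3 + 1 := ⟨_, rfl⟩
  have hn' : n = 3 * (b - 1) := by rw [hb]; ring
  subst hn'
  have E : ∀ t ∈ U, b * (b - 2) * m t ^ 2 + (b ^ 2 - 1) * l t ^ 2 = 0 := by
    intro t ht
    have h := h3 t ht
    rw [d2 t ht, d1 t ht, htau t ht] at h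
    have hl := hl t ht
    have hb1 : b - 1 ≠ 0 := by intro h; linarith
    have : (4 * (b - 1) * l t) * (b * (b - 2) * m t ^ 2 + (b ^ 2 - 1) * l t ^ 2) = 0 := by
      linear_combination h
    rcases mul_eq_zero.mp this with h | h
    · exact absurd h (by positivity)
    · exact h
  obtain ⟨t, ht⟩ := hne
  have e0 := E t ht
  have e1 : b * (b - 2) * (2 * m t * (m t ^ 2 - (b - 1) * l t ^ 2)) + (b ^ 2 - 1) * (2 * l t * (b * l t * m t)) = 0 := by
    have hd : HasDerivAt (fun t => b * (b - 2) * m t ^ 2 + (b ^ 2 - 1) * l t ^ 2)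
        (b * (b - 2) * (2 * m t * (m t ^ 2 - (b - 1) * l t ^ 2)) + (b ^ 2 - 1) * (2 * l t * (b * l t * m t))) t := by
      refine ((((h2 t ht).fun_pow 2).const_mul (b * (b - 2))).fun_add (((h1 t ht).fun_pow 2).const_mul (b ^ 2 - 1))).congr_deriv ?_
      push_cast; ring
    have : (fun t => b * (b - 2) * m t ^ 2 + (b ^ 2 - 1) * l t ^ 2) =ᶠ[nhds t] fun _ => 0 := (nh t ht).mono E
    rw [← hd.deriv, this.deriv_eq]; simp
  have hl2 : 0 < l t ^ 2 := by have := hl t ht; positivity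
  have hb1 : 1 < b := by linarith
  have hB : 0 < (b ^ 2 - 1) * l t ^ 2 := mul_pos (by nlinarith) hl2
  have hm : m t ≠ 0 := by
    intro h; rw [h] at e0; simp at e0; rcases e0 with e0 | e0
    · nlinarith
    · exact hl t ht e0
  have e2 : m t * ((b - 1) * (2 * b - 1) * l t ^ 2) = 0 := by
    linear_combination (1 / 2) * e1 - m t * e0
  rcases mul_eq_zero.mp e2 with h | h
  · exact hm h
  · have : 0 < (b - 1) * (2 * b - 1) * l t ^ 2 := mul_pos (mul_pos (by linarith) (by linarith)) hl2
    linarith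

theorem case_c (n c : ℝ) (hc : c ≠ 0) (p S tau : ℝ → ℝ) (U : Set ℝ) (hU : IsOpen U) (hne : U.Nonempty)
    (hpt : ∀ t ∈ U, p t * tau t = 2 * c)
    (hp : ∀ t ∈ U, HasDerivAt p (p t * c - (p t ^ 2 + 1) * tau t / 2) t)
    (ht : ∀ t ∈ U, HasDerivAt tau (p t * tau t ^ 2 / 2 + n * c * tau t / 3 + 2 / 3 * p t * S t + c * tau t) t)
    (h3 : ∀ t ∈ U, -(deriv (deriv tau) t) + deriv tau t * (p t * (3 / 2) * tau t + n * c)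
       + tau t * (tau t ^ 2 / 4 + S t) = 0) : False := by
  have nh : ∀ t ∈ U, ∀ᶠ z in nhds t, z ∈ U := fun t ht => hU.mem_nhds ht
  have d1 : ∀ t ∈ U, deriv tau t = tau t ^ 3 / (4 * c) := by
    intro t hm
    have hd := (hp t hm).mul (ht t hm).differentiableAt.hasDerivAt
    have : (p * tau) =ᶠ[nhds t] fun _ => 2 * c := (nh t hm).mono hpt
    have h0 := hd.deriv
    rw [this.deriv_eq] at h0
    simp only [deriv_const] at h0
    have e := hpt t hm
    have htau : tau t ≠ 0 := by intro h; rw [h] at e; simp at e; exact hc e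
    have e2 : p t = 2 * c / tau t := by field_simp; exact e
    rw [e2] at h0
    field_simp at h0 ⊢
    have : c * (4 * c * deriv tau t - tau t ^ 3) = 0 := by linear_combination (-c) * h0
    rcases mul_eq_zero.mp this with h | h
    · exact absurd h hc
    · linear_combination h
  obtain ⟨t, hm⟩ := hne
  have d2 : deriv (deriv tau) t = 3 * tau t ^ 2 * (tau t ^ 3 / (4 * c)) / (4 * c) := by
    have : deriv tau =ᶠ[nhds t] fun t => tau t ^ 3 / (4 * c) := (nh t hm).mono d1
    rw [this.deriv_eq]
    have := (((ht t hm).differentiableAt.hasDerivAt).pow 3).div_const (4 * c)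
    rw [d1 t hm] at this
    have := this.deriv
    simpa using this
  have e := hpt t hm
  have htau : tau t ≠ 0 := by intro h; rw [h] at e; simp at e; exact hc e
  have e1 := (ht t hm).deriv
  have h := h3 t hm
  rw [d2, d1 t hm] at h
  rw [d1 t hm] at e1
  have e2 : p t = 2 * c / tau t := by field_simp; exact e
  rw [e2] at h e1
  have hS : S t = 3 / (4 * c) * tau t * (tau t ^ 3 / (4 * c) - 3 * c * tau t - n * c * tau t / 3 + c * tau t) := by
    field_simp at e1 ⊢
    linear_combination (-1) * e1
  rw [hS] at h
  have : tau t ^ 3 = 0 := by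
    field_simp at h
    ring_nf at h
    have h' : tau t ^ 3 * c ^ 2 = 0 := by linarith
    rcases mul_eq_zero.mp h' with h' | h'
    · exact h'
    · exact absurd h' (by positivity)
  exact htau (by simpa using this)

theorem case_zero_alg {ι : Type*} (s : Finset ι) (lam : ι → ℝ → ℝ) (p tau : ℝ → ℝ) (U : Set ℝ) (hU : IsOpen U)
    (htau : ∀ t, tau t = (2/3) * ∑ i ∈ s, lam i t)
    (hl : ∀ i, ∀ t ∈ U, HasDerivAt (lam i) ((tau t / 2 + lam i t) * (p t * lam i t)) t)
    (hp : ∀ t ∈ U, HasDerivAt p (-(p t ^ 2 + 1) * tau t / 2) t)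
    (h3 : ∀ t ∈ U, -(deriv (deriv tau) t) + deriv tau t * (∑ i ∈ s, p t * lam i t)
       + tau t * (tau t ^ 2 / 4 + ∑ i ∈ s, lam i t ^ 2) = 0) :
    ∀ t ∈ U, (1 + p t ^ 2) * (3 / 8 * tau t ^ 3 - ∑ i ∈ s, lam i t ^ 3) +
      (∑ i ∈ s, lam i t ^ 3) + tau t * ∑ i ∈ s, lam i t ^ 2 = 0 := by
  have nh : ∀ t ∈ U, ∀ᶠ z in nhds t, z ∈ U := fun t ht => hU.mem_nhds ht
  have hs : ∀ t, ∑ i ∈ s, lam i t = 3 / 2 * tau t := by intro t; rw [htau]; ring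
  have d1 : ∀ t ∈ U, HasDerivAt tau (p t * tau t ^ 2 / 2 + 2 / 3 * p t * ∑ i ∈ s, lam i t ^ 2) t := by
    intro t ht
    have h := (HasDerivAt.fun_sum (u := s) fun i _ => hl i t ht).const_mul (2 / 3 : ℝ)
    have e : tau = fun t => (2/3) * ∑ i ∈ s, lam i t := funext htau
    rw [← e] at h
    refine h.congr_deriv (Eq.symm ?_)
    have : ∑ i ∈ s, (tau t / 2 + lam i t) * (p t * lam i t) = tau t / 2 * p t * (∑ i ∈ s, lam i t) + p t * ∑ i ∈ s, lam i t ^ 2 := by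
      rw [Finset.mul_sum, Finset.mul_sum, ← Finset.sum_add_distrib]
      exact Finset.sum_congr rfl fun i _ => by ring
    rw [this, hs]; ring
  have dS : ∀ t ∈ U, HasDerivAt (fun t => ∑ i ∈ s, lam i t ^ 2) (p t * (tau t * (∑ i ∈ s, lam i t ^ 2) + 2 * ∑ i ∈ s, lam i t ^ 3)) t := by
    intro t ht
    have h := (HasDerivAt.fun_sum (u := s) fun i _ => (hl i t ht).fun_pow 2)
    refine h.congr_deriv (Eq.symm ?_)
    rw [mul_add, Finset.mul_sum, Finset.mul_sum, Finset.mul_sum, Finset.mul_sum, ← Finset.sum_add_distrib]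
    exact Finset.sum_congr rfl fun i _ => by push_cast; ring
  intro t ht
  have d2 := (((hp t ht).fun_mul ((d1 t ht).fun_pow 2)).div_const 2).fun_add (((hp t ht).const_mul (2 / 3)).fun_mul (dS t ht))
  have e : deriv tau =ᶠ[nhds t] _ := (nh t ht).mono fun t ht => (d1 t ht).deriv
  have h := h3 t ht
  rw [e.deriv_eq, d2.deriv, (d1 t ht).deriv, ← Finset.mul_sum, hs] at h
  push_cast at h
  linear_combination (3 / 4) * h

open Polynomial in
theorem poly_core {ι : Type*} [DecidableEq ι] (s : Finset ι) (hs : s.Nonempty) (a : ι → ℝ) (Q D N : ℝ[X]) (R : ι → ℝ[X])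
    (hQ : Q = ∏ i ∈ s, (X + C (a i))) (hR : ∀ i, R i = ∏ j ∈ s.erase i, (X + C (a j)))
    (hD : D = (C (1/9)) * (∑ i ∈ s, R i) ^ 3 - ∑ i ∈ s, R i ^ 3)
    (hN : N = -((∑ i ∈ s, R i ^ 3) + C (2/3) * ((∑ i ∈ s, R i) * (∑ i ∈ s, R i ^ 2))))
    (hN0 : N ≠ 0) (hD0 : D ≠ 0)
    (hdeg : N.natDegree ≠ D.natDegree)
    (h : 3 * (derivative N * D - N * derivative D) * Q = 2 * N * D * ∑ i ∈ s, R i) : False := by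
  obtain ⟨m, hm⟩ : ∃ m, s.card = m + 1 := ⟨s.card - 1, by have := hs.card_pos; omega⟩
  have hRm : ∀ i ∈ s, (R i).Monic := by
    intro i _; rw [hR]; exact monic_prod_of_monic _ _ fun j _ => monic_X_add_C _
  have hRd : ∀ i ∈ s, (R i).natDegree = m := by
    intro i hi
    rw [hR, natDegree_prod_of_monic _ _ fun j _ => monic_X_add_C _]
    simp [Finset.card_erase_of_mem hi, hm]
  have hpow : ∀ k, (∑ i ∈ s, R i ^ k).natDegree ≤ k * m ∧ (∑ i ∈ s, R i ^ k).coeff (k * m) = (m : ℝ) + 1 := by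
    intro k
    constructor
    · apply natDegree_sum_le_of_forall_le
      intro i hi
      rw [(hRm i hi).natDegree_pow, hRd i hi]
    · rw [finsetSum_coeff, Finset.sum_congr rfl (g := fun _ => (1:ℝ))]
      · simp [hm]
      · intro i hi
        have := ((hRm i hi).pow k).coeff_natDegree
        rwa [(hRm i hi).natDegree_pow, hRd i hi] at this
  have h1 := hpow 1
  have h2 := hpow 2
  have h3 := hpow 3
  simp only [pow_one, one_mul] at h1
  have hA3d : ((∑ i ∈ s, R i) ^ 3).natDegree ≤ 3 * m := natDegree_pow_le_of_le 3 h1.1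
  have hA3 : ((∑ i ∈ s, R i) ^ 3).coeff (3 * m) = ((m:ℝ) + 1) ^ 3 := by
    rw [coeff_pow_of_natDegree_le h1.1, h1.2]
  have hABd : ((∑ i ∈ s, R i) * (∑ i ∈ s, R i ^ 2)).natDegree ≤ 3 * m := by
    refine (natDegree_mul_le_of_le h1.1 h2.1).trans (by omega)
  have hAB : ((∑ i ∈ s, R i) * (∑ i ∈ s, R i ^ 2)).coeff (3 * m) = ((m:ℝ) + 1) ^ 2 := by
    rw [show 3 * m = m + 2 * m by ring, coeff_mul_add_eq_of_natDegree_le h1.1 h2.1, h1.2, h2.2]; ring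
  have hNd : N.natDegree = 3 * m := by
    apply natDegree_eq_of_le_of_coeff_ne_zero
    · rw [hN, natDegree_neg]
      exact natDegree_add_le_of_degree_le h3.1 ((natDegree_C_mul_le _ _).trans hABd)
    · rw [hN, coeff_neg, coeff_add, coeff_C_mul, hAB, h3.2]
      have : (0:ℝ) < (m : ℝ) + 1 + 2 / 3 * ((m:ℝ) + 1) ^ 2 := by positivity
      linarith
  have hm2 : m = 2 := by
    by_contra hm2
    apply hdeg
    rw [hNd]
    symm
    apply natDegree_eq_of_le_of_coeff_ne_zero
    · rw [hD]
      exact natDegree_sub_le_of_le ((natDegree_C_mul_le _ _).trans hA3d) h3.1 |>.trans (by simp)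
    · rw [hD, coeff_sub, coeff_C_mul, hA3, h3.2]
      intro h0
      have : ((m:ℝ) + 1) * ((m:ℝ) + 4) * ((m:ℝ) - 2) = 0 := by linear_combination 9 * h0
      have h5 : (m:ℝ) - 2 ≠ 0 := by
        intro h; apply hm2; have : (m:ℝ) = 2 := by linarith
        exact_mod_cast this
      have h6 : (m:ℝ) + 1 ≠ 0 := by positivity
      have h7 : (m:ℝ) + 4 ≠ 0 := by positivity
      simp [h5, h6, h7] at this
  -- simple root impossible
  have simple : ∀ i ∈ s, ¬ ∀ j ∈ s, j ≠ i → a j ≠ a i := by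
    intro i hi hj
    obtain ⟨r, hr⟩ : ∃ r, r = (R i).eval (-a i) := ⟨_, rfl⟩
    have hr0 : r ≠ 0 := by
      rw [hr, hR, eval_prod, Finset.prod_ne_zero_iff]
      intro j hj'
      have := hj j (Finset.mem_of_mem_erase hj') (Finset.ne_of_mem_erase hj')
      simp only [eval_add, eval_X, eval_C]
      intro h; apply this; linarith
    have hR0 : ∀ j ∈ s, j ≠ i → (R j).eval (-a i) = 0 := by
      intro j _ hji
      rw [hR, eval_prod]
      exact Finset.prod_eq_zero (Finset.mem_erase.mpr ⟨hji.symm, hi⟩) (by simp)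
    have hs : ∀ k, k ≠ 0 → (∑ j ∈ s, (R j) ^ k).eval (-a i) = r ^ k := by
      intro k hk
      rw [eval_finsetSum, Finset.sum_eq_single_of_mem i hi]
      · simp [hr]
      · intro j hj hji; simp [hR0 j hj hji, hk]
    have s1 := hs 1 one_ne_zero
    simp only [pow_one] at s1
    have hQ0 : Q.eval (-a i) = 0 := by
      rw [hQ, eval_prod]; exact Finset.prod_eq_zero hi (by simp)
    have e := congrArg (eval (-a i)) h
    have eD : D.eval (-a i) = -(8/9) * r ^ 3 := by
      rw [hD]; simp only [eval_sub, eval_mul, eval_C, eval_pow, s1, hs 3 (by norm_num)]; ring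
    have eN : N.eval (-a i) = -(5/3) * r ^ 3 := by
      rw [hN]; simp only [eval_neg, eval_add, eval_mul, eval_C, s1, hs 3 (by norm_num), hs 2 (by norm_num)]; ring
    rw [eval_mul, hQ0, eval_mul, eval_mul, eval_mul, eval_mul, eD, eN, s1] at e
    have e2 : (eval (-a i) (2:ℝ[X])) = 2 := by simp
    rw [e2, mul_zero] at e
    have : r ^ 7 = 0 := by linear_combination (-27/80) * e
    exact hr0 (by simpa using this)
  subst hm2
  obtain ⟨x, y, z, hxy, hxz, hyz, rfl⟩ := Finset.card_eq_three.mp hm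
  have sx := simple x (by simp)
  have sy := simple y (by simp)
  have sz := simple z (by simp)
  have key : a x = a y ∧ a x = a z := by
    by_contra hk
    clear h1 h2
    by_cases h1 : a x = a y
    · have h2 : a x ≠ a z := fun h => hk ⟨h1, h⟩
      apply sz; intro j hj hjz
      simp only [Finset.mem_insert, Finset.mem_singleton] at hj
      rcases hj with rfl | rfl | rfl
      · exact h2
      · rw [← h1]; exact h2
      · exact absurd rfl hjz
    · by_cases h2 : a x = a z
      · apply sy; intro j hj hjz
        simp only [Finset.mem_insert, Finset.mem_singleton] at hj
        rcases hj with rfl | rfl | rfl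
        · exact h1
        · exact absurd rfl hjz
        · rw [← h2]; exact h1
      · apply sx; intro j hj hjz
        simp only [Finset.mem_insert, Finset.mem_singleton] at hj
        rcases hj with rfl | rfl | rfl
        · exact absurd rfl hjz
        · exact Ne.symm h1
        · exact Ne.symm h2
  have hall : ∀ i ∈ ({x, y, z} : Finset ι), R i = (X + C (a x)) ^ 2 := by
    intro i hi
    rw [hR, Finset.prod_congr rfl (g := fun _ => X + C (a x))]
    · simp [Finset.card_erase_of_mem hi, hm]
    · intro j hj
      have := Finset.mem_of_mem_erase hj
      simp only [Finset.mem_insert, Finset.mem_singleton] at this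
      rcases this with rfl | rfl | rfl
      · rfl
      · rw [key.1]
      · rw [key.2]
  apply hD0
  rw [hD, Finset.sum_congr rfl hall, Finset.sum_congr (f := fun i => R i ^ 3) (g := fun _ => ((X + C (a x)) ^ 2) ^ 3) rfl (fun i hi => by simp only [hall i hi])]
  rw [Finset.sum_const, Finset.sum_const, hm, nsmul_eq_mul, nsmul_eq_mul]
  have : (C (1/9 : ℝ)) * 9 = (1 : ℝ[X]) := by
    rw [show (9 : ℝ[X]) = C 9 from rfl, ← C_mul]; norm_num
  push_cast
  linear_combination 3 * (X + C (a x)) ^ 6 * this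

open Polynomial in
theorem case_zero_core {ι : Type*} [DecidableEq ι] (s : Finset ι) (hs : s.Nonempty) (lam : ι → ℝ → ℝ)
    (p tau : ℝ → ℝ) (U : Set ℝ) (hU : IsOpen U) (hUc : IsPreconnected U) (hne : U.Nonempty)
    (htau : ∀ t ∈ U, tau t = (2/3) * ∑ i ∈ s, lam i t)
    (hl : ∀ i, ∀ t ∈ U, HasDerivAt (lam i) ((tau t / 2 + lam i t) * (p t * lam i t)) t)
    (hp : ∀ t ∈ U, HasDerivAt p (-(p t ^ 2 + 1) * tau t / 2) t)
    (hp0 : ∀ t ∈ U, p t ≠ 0)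
    (hl0 : ∀ i ∈ s, ∀ t ∈ U, lam i t ≠ 0)
    (halg : ∀ t ∈ U, (1 + p t ^ 2) * (3 / 8 * tau t ^ 3 - ∑ i ∈ s, lam i t ^ 3) +
      (∑ i ∈ s, lam i t ^ 3) + tau t * ∑ i ∈ s, lam i t ^ 2 = 0) : False := by
  obtain ⟨t0, ht0⟩ := hne
  obtain ⟨i0, hi0⟩ := hs
  have nh : ∀ t ∈ U, ∀ᶠ z in nhds t, z ∈ U := fun t ht => hU.mem_nhds ht
  obtain ⟨u, hu⟩ : ∃ u : ℝ → ℝ, u = fun t => Real.sqrt (1 + p t ^ 2) := ⟨_, rfl⟩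
  have hu2 : ∀ t, u t ^ 2 = 1 + p t ^ 2 := by
    intro t; rw [hu]; exact Real.sq_sqrt (by positivity)
  have hupos : ∀ t, 0 < u t := by
    intro t; rw [hu]; exact Real.sqrt_pos.mpr (by positivity)
  have hud : ∀ t ∈ U, HasDerivAt u (-(p t * u t * tau t / 2)) t := by
    intro t ht
    have h1 : HasDerivAt (fun t => 1 + p t ^ 2) (2 * p t * (-(p t ^ 2 + 1) * tau t / 2)) t := by
      refine (((hp t ht).fun_pow 2).const_add 1).congr_deriv ?_
      push_cast; ring
    have h2 := h1.sqrt (by positivity)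
    have e : Real.sqrt (1 + p t ^ 2) = u t := by rw [hu]
    rw [e, ← hu] at h2
    refine h2.congr_deriv ?_
    have := (hupos t).ne'
    have e2 : p t ^ 2 + 1 = u t ^ 2 := by rw [hu2]; ring
    rw [e2]; field_simp
  -- reciprocal functions
  obtain ⟨x, hx⟩ : ∃ x : ι → ℝ → ℝ, x = fun i t => (lam i t * u t)⁻¹ := ⟨_, rfl⟩
  have hxd : ∀ i ∈ s, ∀ t ∈ U, HasDerivAt (x i) (-(p t / u t)) t := by
    intro i hi t ht
    have h0 := hl0 i hi t ht
    have h1 := (hupos t).ne'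
    rw [hx]
    refine (((hl i t ht).fun_mul (hud t ht)).fun_inv (mul_ne_zero h0 h1)).congr_deriv ?_
    field_simp
    ring
  obtain ⟨a, ha⟩ : ∃ a : ι → ℝ, a = fun i => x i t0 - x i0 t0 := ⟨_, rfl⟩
  have hxa : ∀ i ∈ s, ∀ t ∈ U, x i t = x i0 t + a i := by
    intro i hi t ht
    have hd : ∀ t ∈ U, HasDerivAt (fun t => x i t - x i0 t) 0 t := by
      intro t ht
      exact ((hxd i hi t ht).fun_sub (hxd i0 hi0 t ht)).congr_deriv (by ring)
    have := hU.is_const_of_deriv_eq_zero hUc (f := fun t => x i t - x i0 t)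
      (fun t ht => (hd t ht).differentiableAt.differentiableWithinAt)
      (fun t ht => (hd t ht).deriv) ht ht0
    rw [ha]; simp only; linarith
  have hxl : ∀ i ∈ s, ∀ t ∈ U, (x i0 t + a i) * (lam i t * u t) = 1 := by
    intro i hi t ht
    rw [← hxa i hi t ht, hx]
    exact inv_mul_cancel₀ (mul_ne_zero (hl0 i hi t ht) (hupos t).ne')
  obtain ⟨Q, hQ⟩ : ∃ Q : ℝ[X], Q = ∏ i ∈ s, (X + C (a i)) := ⟨_, rfl⟩
  obtain ⟨R, hR'⟩ : ∃ R : ι → ℝ[X], R = fun i => ∏ j ∈ s.erase i, (X + C (a j)) := ⟨_, rfl⟩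
  have hR : ∀ i, R i = ∏ j ∈ s.erase i, (X + C (a j)) := fun i => by rw [hR']
  obtain ⟨D, hD⟩ : ∃ D : ℝ[X], D = (C (1/9)) * (∑ i ∈ s, R i) ^ 3 - ∑ i ∈ s, R i ^ 3 := ⟨_, rfl⟩
  obtain ⟨N, hN⟩ : ∃ N : ℝ[X], N = -((∑ i ∈ s, R i ^ 3) + C (2/3) * ((∑ i ∈ s, R i) * (∑ i ∈ s, R i ^ 2))) := ⟨_, rfl⟩
  have hQR : ∀ i ∈ s, Q = (X + C (a i)) * R i := by
    intro i hi; rw [hQ, hR, Finset.mul_prod_erase s (fun i => X + C (a i)) hi]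
  have hQ' : derivative Q = ∑ i ∈ s, R i := by
    rw [hQ, derivative_prod_finset]
    exact Finset.sum_congr rfl fun i _ => by simp [hR]
  have hRe : ∀ i ∈ s, ∀ t ∈ U, (R i).eval (x i0 t) = Q.eval (x i0 t) * (lam i t * u t) := by
    intro i hi t ht
    rw [hQR i hi, eval_mul, eval_add, eval_X, eval_C]
    linear_combination (-(R i).eval (x i0 t)) * hxl i hi t ht
  have hRk : ∀ k, ∀ t ∈ U, (∑ i ∈ s, R i ^ k).eval (x i0 t) = (Q.eval (x i0 t) * u t) ^ k * ∑ i ∈ s, lam i t ^ k := by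
    intro k t ht
    rw [eval_finsetSum, Finset.mul_sum]
    refine Finset.sum_congr rfl fun i hi => ?_
    rw [eval_pow, hRe i hi t ht]; ring
  have hR1 : ∀ t ∈ U, (∑ i ∈ s, R i).eval (x i0 t) = (Q.eval (x i0 t) * u t) * (3 / 2 * tau t) := by
    intro t ht
    have := hRk 1 t ht
    simp only [pow_one] at this
    rw [this, htau t ht]; ring
  have hDN : ∀ t ∈ U, D.eval (x i0 t) * u t ^ 2 = N.eval (x i0 t) := by
    intro t ht
    rw [hD, hN]
    simp only [eval_sub, eval_neg, eval_add, eval_mul, eval_C, eval_pow, hR1 t ht, hRk 2 t ht, hRk 3 t ht]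
    rw [hu2 t]
    linear_combination (Q.eval (x i0 t) * u t) ^ 3 * halg t ht
  have hN0 : N ≠ 0 := by
    intro h0
    obtain ⟨y, hy⟩ : ∃ y : ℝ, y = 1 + ∑ j ∈ s, |a j| := ⟨_, rfl⟩
    have hpos : ∀ i ∈ s, 0 < (R i).eval y := by
      intro i _
      rw [hR, eval_prod]
      refine Finset.prod_pos fun j hj => ?_
      have := Finset.single_le_sum (f := fun j => |a j|) (fun j _ => abs_nonneg _) (Finset.mem_of_mem_erase hj)
      have h2 := neg_abs_le (a j)
      simp only [eval_add, eval_X, eval_C] at this ⊢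
      linarith
    have hk : ∀ k, 0 < (∑ i ∈ s, R i ^ k).eval y := by
      intro k
      rw [eval_finsetSum]
      refine Finset.sum_pos (fun i hi => ?_) ⟨i0, hi0⟩
      rw [eval_pow]; exact pow_pos (hpos i hi) k
    have h1 := hk 1
    have h2 := hk 2
    have h3 := hk 3
    simp only [pow_one] at h1
    have e := congrArg (eval y) h0
    rw [hN] at e
    simp only [eval_neg, eval_add, eval_mul, eval_C, eval_zero] at e
    have := mul_pos h1 h2
    linarith
  have hg0 : -(p t0 / u t0) ≠ 0 := neg_ne_zero.mpr (div_ne_zero (hp0 t0 ht0) (hupos t0).ne')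
  have hD0 : D ≠ 0 := by
    intro h0
    apply hN0
    refine poly_zero N (x i0) _ t0 U hU ht0 (hxd i0 hi0 t0 ht0) hg0 ?_
    intro t ht
    rw [← hDN t ht, h0]; simp
  have heq : 3 * (derivative N * D - N * derivative D) * Q = 2 * N * D * ∑ i ∈ s, R i := by
    rw [← sub_eq_zero]
    refine poly_zero _ (x i0) _ t0 U hU ht0 (hxd i0 hi0 t0 ht0) hg0 ?_
    intro t ht
    have dD := (D.hasDerivAt (x i0 t)).comp t (hxd i0 hi0 t ht)
    have dN := (N.hasDerivAt (x i0 t)).comp t (hxd i0 hi0 t ht)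
    have dL := dD.mul ((hud t ht).fun_pow 2)
    have ee : ((fun y => D.eval y) ∘ x i0) * (fun t => u t ^ 2) =ᶠ[nhds t] ((fun y => N.eval y) ∘ x i0) :=
      (nh t ht).mono fun t ht => hDN t ht
    have h := ee.deriv_eq
    rw [dL.deriv, dN.deriv] at h
    have hDN' := hDN t ht
    have h1 := hR1 t ht
    have hut := (hupos t).ne'
    have hpt := hp0 t ht
    simp only [eval_sub, eval_mul, h1, Function.comp_apply] at h ⊢
    have e2 : eval (x i0 t) (2:ℝ[X]) = 2 := by simp
    have e3 : eval (x i0 t) (3:ℝ[X]) = 3 := by simp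
    rw [e2, e3, ← hDN']
    push_cast at h
    have h' : eval (x i0 t) (derivative N) = eval (x i0 t) (derivative D) * u t ^ 2 + D.eval (x i0 t) * u t ^ 3 * tau t := by
      field_simp at h
      have h4 : p t * (eval (x i0 t) (derivative N) - (eval (x i0 t) (derivative D) * u t ^ 2 + D.eval (x i0 t) * u t ^ 3 * tau t)) = 0 := by
        linear_combination (p t) * h
      rcases mul_eq_zero.mp h4 with h4 | h4
      · exact absurd h4 hpt
      · linarith
    rw [h']; ring
  refine poly_core s ⟨i0, hi0⟩ a Q D N R hQ hR hD hN hN0 hD0 ?_ heq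
  refine deg_ne N D Q hN0 hD0 ?_ (by rw [hQ']; exact heq)
  rw [hQ, natDegree_prod_of_monic _ _ fun j _ => monic_X_add_C _]
  simpa using Finset.card_pos.mpr ⟨i0, hi0⟩

theorem case_zero {ι : Type*} [Fintype ι] (lam : ι → ℝ → ℝ) (p tau : ℝ → ℝ) (U : Set ℝ) (hU : IsOpen U)
    (hne : U.Nonempty)
    (htau : ∀ t, tau t = (2/3) * ∑ i, lam i t)
    (hl : ∀ i, ∀ t ∈ U, HasDerivAt (lam i) ((tau t / 2 + lam i t) * (p t * lam i t)) t)
    (hp : ∀ t ∈ U, HasDerivAt p (-(p t ^ 2 + 1) * tau t / 2) t)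
    (ht0 : ∀ t ∈ U, tau t ≠ 0)
    (h3 : ∀ t ∈ U, -(deriv (deriv tau) t) + deriv tau t * (∑ i, p t * lam i t)
       + tau t * (tau t ^ 2 / 4 + ∑ i, lam i t ^ 2) = 0) : False := by
  classical
  have halg := case_zero_alg Finset.univ lam p tau U hU htau hl hp h3
  obtain ⟨V, hVU, hV, hVne, hVp⟩ := shrink p U hU hne fun t ht => (hp t ht).continuousAt.continuousWithinAt
  have hVp : ∀ t ∈ V, p t ≠ 0 := by
    rcases hVp with h | h
    · exfalso
      obtain ⟨t, ht⟩ := hVne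
      have e : p =ᶠ[nhds t] fun _ => 0 := Filter.Eventually.mono (hV.mem_nhds ht) h
      have h1 := (hp t (hVU ht)).deriv
      rw [e.deriv_eq, deriv_const] at h1
      have h2 := ht0 t (hVU ht)
      have : (p t ^ 2 + 1) * tau t = 0 := by linarith
      rcases mul_eq_zero.mp this with h | h
      · have : 0 < p t ^ 2 + 1 := by positivity
        linarith
      · exact h2 h
    · exact h
  obtain ⟨W, hWV, hW, ⟨t0, hWt⟩, hWl⟩ := shrink_all Finset.univ lam V hV hVne
    fun i t ht => (hl i t (hVU ht)).continuousAt.continuousWithinAt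
  obtain ⟨r, hr, hB⟩ := Metric.isOpen_iff.mp hW t0 hWt
  have hBU : Metric.ball t0 r ⊆ U := hB.trans (hWV.trans hVU)
  obtain ⟨s, hs⟩ : ∃ s : Finset ι, s = Finset.univ.filter fun i => lam i t0 ≠ 0 := ⟨_, rfl⟩
  have hin : ∀ i ∈ s, ∀ t ∈ W, lam i t ≠ 0 := by
    intro i hi
    rcases hWl i (Finset.mem_univ i) with h | h
    · rw [hs] at hi; simp at hi; exact absurd (h t0 hWt) hi
    · exact h
  have hout : ∀ i, i ∉ s → ∀ t ∈ W, lam i t = 0 := by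
    intro i hi
    rcases hWl i (Finset.mem_univ i) with h | h
    · exact h
    · rw [hs] at hi; simp at hi; exact absurd hi (h t0 hWt)
  have hsum : ∀ k, k ≠ 0 → ∀ t ∈ W, ∑ i ∈ s, lam i t ^ k = ∑ i, lam i t ^ k := by
    intro k hk t ht
    exact Finset.sum_subset (Finset.subset_univ s) fun i _ hi => by simp [hout i hi t ht, hk]
  have hsum1 : ∀ t ∈ W, ∑ i ∈ s, lam i t = ∑ i, lam i t := by
    intro t ht; simpa using hsum 1 one_ne_zero t ht
  have hsne : s.Nonempty := by
    rw [Finset.nonempty_iff_ne_empty]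
    intro h
    have h1 := hsum1 t0 hWt
    rw [h, Finset.sum_empty] at h1
    exact ht0 t0 (hVU (hWV hWt)) (by rw [htau, ← h1]; simp)
  refine case_zero_core s hsne lam p tau (Metric.ball t0 r) Metric.isOpen_ball
    (convex_ball t0 r).isPreconnected ⟨t0, Metric.mem_ball_self hr⟩ ?_ ?_ ?_ ?_ ?_ ?_
  · intro t ht; rw [hsum1 t (hB ht)]; exact htau t
  · intro i t ht; exact hl i t (hBU ht)
  · intro t ht; exact hp t (hBU ht)
  · intro t ht; exact hVp t (hWV (hB ht))
  · intro i hi t ht; exact hin i hi t (hB ht)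
  · intro t ht
    rw [hsum 3 (by norm_num) t (hB ht), hsum 2 (by norm_num) t (hB ht)]
    exact halg t (hBU ht)


/-- Lemma (`psi ≠ const`): `ψ` is not a constant function on `I`. -/
theorem stmt_15 (n₁ : ℕ) (hn : 1 ≤ n₁) (K : ℝ) (hK : K = 0)
    (I : Set ℝ) (hI : IsOpen I) (hIconn : I.OrdConnected)
    (lam mu : Fin n₁ → ℝ → ℝ)
    (hlam : ∀ i, AnalyticOnNhd ℝ (lam i) I)
    (hmu : ∀ i, AnalyticOnNhd ℝ (mu i) I)
    (tau : ℝ → ℝ) (htau : ∀ t, tau t = (2/3) * ∑ i, lam i t)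
    (hode1 : ∀ i, ∀ t ∈ I, HasDerivAt (lam i) ((tau t / 2 + lam i t) * mu i t) t)
    (hode2 : ∀ i, ∀ t ∈ I,
      HasDerivAt (mu i) ((mu i t) ^ 2 - tau t / 2 * lam i t + K) t)
    (hode3 : ∀ t ∈ I,
      -(deriv (deriv tau) t) + deriv tau t * (∑ i, mu i t)
        + tau t * ((tau t) ^ 2 / 4 - ((n₁ : ℝ) + 1) * K + ∑ i, (lam i t) ^ 2) = 0)
    (htau_ne : ¬ ∀ t ∈ I, tau t = 0)
    (phi psi : ℝ → ℝ)
    (hphi : AnalyticOnNhd ℝ phi I) (hpsi : AnalyticOnNhd ℝ psi I)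
    (hlin : ∀ i, ∀ t ∈ I, mu i t = phi t * lam i t + psi t) :
    ¬ ∃ c : ℝ, ∀ t ∈ I, psi t = c := by
  rintro ⟨c, hc⟩
  subst hK
  have htc : ∀ t ∈ I, ContinuousAt tau t := by
    intro t ht
    have e : tau = fun t => (2/3) * ∑ i, lam i t := funext htau
    rw [e]
    exact ((HasDerivAt.fun_sum (u := Finset.univ) fun i _ => hode1 i t ht).const_mul (2 / 3 : ℝ)).continuousAt
  push Not at htau_ne
  obtain ⟨t0, ht0, htau0⟩ := htau_ne
  obtain ⟨U, hU'⟩ : ∃ U : Set ℝ, U = I ∩ tau ⁻¹' {0}ᶜ := ⟨_, rfl⟩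
  have hUI : U ⊆ I := by rw [hU']; exact Set.inter_subset_left
  have hU : IsOpen U := by
    rw [hU']
    exact ContinuousOn.isOpen_inter_preimage (fun t ht => (htc t ht).continuousWithinAt) hI isOpen_compl_singleton
  have hUt : ∀ t ∈ U, tau t ≠ 0 := by
    rw [hU']; intro t ht; exact ht.2
  have hUne : U.Nonempty := ⟨t0, by rw [hU']; exact ⟨ht0, htau0⟩⟩
  -- derivative relation
  have hrel : ∀ i, ∀ t ∈ I, lam i t * (deriv phi t + (phi t ^ 2 + 1) * tau t / 2 - phi t * c) = c * (c - phi t * tau t / 2) := by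
    intro i t ht
    have hphi' := (hphi t ht).differentiableAt.hasDerivAt
    have h1 := (hphi'.fun_mul (hode1 i t ht)).add_const c
    have e : mu i =ᶠ[nhds t] fun t => phi t * lam i t + c :=
      Filter.Eventually.mono (hI.mem_nhds ht) fun t ht => by rw [hlin i t ht, hc t ht]
    have h2 := e.deriv_eq
    rw [h1.deriv, (hode2 i t ht).deriv, hlin i t ht, hc t ht] at h2
    linear_combination -h2
  by_cases hall : ∀ i j, ∀ t ∈ U, lam i t = lam j t
  · obtain ⟨i0⟩ : Nonempty (Fin n₁) := ⟨⟨0, hn⟩⟩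
    have hmueq : ∀ i, ∀ t ∈ U, mu i t = mu i0 t := by
      intro i t ht; rw [hlin i t (hUI ht), hlin i0 t (hUI ht), hall i i0 t ht]
    have htl : ∀ t ∈ U, tau t = (2 * (n₁ : ℝ) / 3) * lam i0 t := by
      intro t ht
      rw [htau, Finset.sum_congr rfl fun i _ => hall i i0 t ht]
      simp; ring
    refine case_eq n₁ (by exact_mod_cast hn) (lam i0) (mu i0) tau U hU hUne htl ?_ ?_ ?_ ?_
    · intro t ht
      refine (hode1 i0 t (hUI ht)).congr_deriv ?_
      rw [htl t ht]; ring
    · intro t ht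
      refine (hode2 i0 t (hUI ht)).congr_deriv ?_
      rw [htl t ht]; ring
    · intro t ht
      have h := hode3 t (hUI ht)
      rw [Finset.sum_congr rfl fun i _ => hmueq i t ht, Finset.sum_congr (f := fun i => lam i t ^ 2) (g := fun _ => lam i0 t ^ 2) rfl (fun i _ => by simp only [hall i i0 t ht])] at h
      simp only [Finset.sum_const, Finset.card_univ, Fintype.card_fin, nsmul_eq_mul] at h
      linear_combination h
    · intro t ht h0
      exact hUt t ht (by rw [htl t ht, h0, mul_zero])
  · push Not at hall
    obtain ⟨i, j, t1, ht1, hij⟩ := hall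
    obtain ⟨V, hV'⟩ : ∃ V : Set ℝ, V = U ∩ (fun t => lam i t - lam j t) ⁻¹' {0}ᶜ := ⟨_, rfl⟩
    have hVU : V ⊆ U := by rw [hV']; exact Set.inter_subset_left
    have hV : IsOpen V := by
      rw [hV']
      refine ContinuousOn.isOpen_inter_preimage (fun t ht => ?_) hU isOpen_compl_singleton
      exact ((hode1 i t (hUI ht)).continuousAt.sub (hode1 j t (hUI ht)).continuousAt).continuousWithinAt
    have hVne : V.Nonempty := ⟨t1, by rw [hV']; exact ⟨ht1, sub_ne_zero.mpr hij⟩⟩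
    have hVd : ∀ t ∈ V, lam i t - lam j t ≠ 0 := by
      rw [hV']; intro t ht; exact ht.2
    have hVI := hVU.trans hUI
    have hd : ∀ t ∈ V, deriv phi t + (phi t ^ 2 + 1) * tau t / 2 - phi t * c = 0 := by
      intro t ht
      have h1 := hrel i t (hVI ht)
      have h2 := hrel j t (hVI ht)
      refine (mul_eq_zero.mp (?_ : (lam i t - lam j t) * _ = 0)).resolve_left (hVd t ht)
      linear_combination h1 - h2
    have hphi' : ∀ t ∈ V, HasDerivAt phi (phi t * c - (phi t ^ 2 + 1) * tau t / 2) t := by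
      intro t ht
      refine (hphi t (hVI ht)).differentiableAt.hasDerivAt.congr_deriv ?_
      linear_combination hd t ht
    have hmu' : ∀ k, ∀ t ∈ V, mu k t = phi t * lam k t + c := fun k t ht => by
      rw [hlin k t (hVI ht), hc t (hVI ht)]
    by_cases hc0 : c = 0
    · subst hc0
      refine case_zero lam phi tau V hV hVne htau ?_ ?_ (fun t ht => hUt t (hVU ht)) ?_
      · intro k t ht
        refine (hode1 k t (hVI ht)).congr_deriv ?_
        rw [hmu' k t ht]; ring
      · intro t ht
        exact (hphi' t ht).congr_deriv (by ring)
      · intro t ht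
        have h := hode3 t (hVI ht)
        rw [Finset.sum_congr rfl fun k _ => (hmu' k t ht).trans (add_zero _)] at h
        linear_combination h
    · have hs : ∀ t, ∑ k, lam k t = 3 / 2 * tau t := by intro t; rw [htau]; ring
      refine case_c n₁ c hc0 phi (fun t => ∑ k, lam k t ^ 2) tau V hV hVne ?_ hphi' ?_ ?_
      · intro t ht
        have h1 := hrel i t (hVI ht)
        rw [hd t ht, mul_zero] at h1
        have := (mul_eq_zero.mp h1.symm).resolve_left hc0
        linarith
      · intro t ht
        have e : tau = fun t => (2/3) * ∑ i, lam i t := funext htau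
        have h := (HasDerivAt.fun_sum (u := Finset.univ) fun i _ => hode1 i t (hVI ht)).const_mul (2 / 3 : ℝ)
        rw [← e] at h
        refine h.congr_deriv ?_
        have : ∑ k, (tau t / 2 + lam k t) * mu k t = (tau t / 2 * phi t + c) * (∑ k, lam k t) + phi t * (∑ k, lam k t ^ 2) + n₁ * (tau t / 2 * c) := by
          have e1 : (n₁ : ℝ) * (tau t / 2 * c) = ∑ k : Fin n₁, tau t / 2 * c := by simp
          rw [e1, Finset.mul_sum, Finset.mul_sum, ← Finset.sum_add_distrib, ← Finset.sum_add_distrib]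
          exact Finset.sum_congr rfl fun k _ => by rw [hmu' k t ht]; ring
        rw [this, hs]; ring
      · intro t ht
        have h := hode3 t (hVI ht)
        have : ∑ k, mu k t = phi t * (∑ k, lam k t) + n₁ * c := by
          have e1 : (n₁ : ℝ) * c = ∑ k : Fin n₁, c := by simp
          rw [e1, Finset.mul_sum, ← Finset.sum_add_distrib]
          exact Finset.sum_congr rfl fun k _ => hmu' k t ht
        rw [this, hs] at h
        linear_combination h
end

section
/- Let n₁ ≥ 2 and K = 0, let (λ₁,…,λ_{n₁}, μ₁,…,μ_{n₁}) be a real-analytic solution of the system (ODE) on an open interval I, suppose there are real-analytic functions φ, ψ on I with μᵢ = φλᵢ + ψ for all i = 1,…,n₁, and assume in addition that 4(n₁ − 1)·ψ·(n₁ψ + 3τφ) + (1 + φ²)·(9τ² − 4·Σλᵢ²) = 0 holds on I. Then τ ≡ 0 on I. -/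
namespace Biharm

variable {A : Type*} [CommRing A]

/-- Coefficients of the quadratic (in `Z`) relation `G(X,Z) = 0`. -/
def g0 (N X : A) : A := X^2*(28*N^2-24*N-36)+X^3*(8*N^3-56*N^2+48*N)
def g1 (N X : A) : A :=
  63+X*(102*N-198)+X^2*(20*N^2-192*N+108)+X^3*(-8*N^3-40*N^2+48*N)
def g2 (N X : A) : A :=
  -72+X*(-132*N+36)+X^2*(-80*N^2+48*N)+X^3*(-16*N^3+16*N^2)
/-- `X` times the derivatives of the coefficients. -/
def e0 (N X : A) : A := 2*X^2*(28*N^2-24*N-36)+3*X^3*(8*N^3-56*N^2+48*N)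
def e1 (N X : A) : A :=
  X*(102*N-198)+2*X^2*(20*N^2-192*N+108)+3*X^3*(-8*N^3-40*N^2+48*N)
def e2 (N X : A) : A :=
  X*(-132*N+36)+2*X^2*(-80*N^2+48*N)+3*X^3*(-16*N^3+16*N^2)
def h1 (N X : A) : A := 12+(14*N-6)*X+4*N*(N-1)*X^2
def h0 (N X : A) : A := 3+(2*N-6)*X+4*N*(N-1)*X^2
/-- Coefficients of the cubic obtained by differentiating `G`. -/
def d0 (N X : A) : A := -e0 N X*h0 N X
def d1 (N X : A) : A := -e0 N X*h1 N X-e1 N X*h0 N X+(12*X-6)*g1 N X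
def d2 (N X : A) : A := -e1 N X*h1 N X-e2 N X*h0 N X+(12*X-6)*(g1 N X+2*g2 N X)
def d3 (N X : A) : A := -e2 N X*h1 N X+2*(12*X-6)*g2 N X
/-- Remainder of the cubic modulo the quadratic. -/
def r1 (N X : A) : A :=
  g2 N X*(g2 N X*d1 N X-d3 N X*g0 N X) - (g2 N X*d2 N X-d3 N X*g1 N X)*g1 N X
def r0 (N X : A) : A :=
  g2 N X*(g2 N X*d0 N X) - (g2 N X*d2 N X-d3 N X*g1 N X)*g0 N X
/-- Eliminant. -/
def RR (N X : A) : A :=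
  g2 N X*r0 N X^2-g1 N X*r0 N X*r1 N X+g0 N X*r1 N X^2

lemma elim (N X Z : A) (hG : g0 N X + g1 N X * Z + g2 N X * Z^2 = 0)
    (hC : d0 N X + d1 N X * Z + d2 N X * Z^2 + d3 N X * Z^3 = 0) : RR N X = 0 := by
  have hr : r1 N X * Z + r0 N X = 0 := by
    simp only [r1, r0]
    linear_combination (g2 N X)^2 * hC - (g2 N X * d3 N X * Z + (g2 N X*d2 N X-d3 N X*g1 N X)) * hG
  simp only [RR]
  have h2 : r0 N X = - (r1 N X * Z) := by linear_combination hr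
  rw [h2]
  linear_combination (r1 N X)^2 * hG

lemma RR_half (N : ℝ) (hN : N = 2 ∨ 3 ≤ N) : RR N (1/2) ≠ 0 := by
  rcases hN with rfl | h
  · norm_num [RR, r1, r0, d0, d1, d2, d3, h0, h1, e0, e1, e2, g0, g1, g2]
  · obtain ⟨k, rfl⟩ : ∃ k, N = k + 3 := ⟨N - 3, by ring⟩
    have hk : 0 ≤ k := by linarith
    apply ne_of_gt
    simp only [RR, r1, r0, d0, d1, d2, d3, h0, h1, e0, e1, e2, g0, g1, g2]
    ring_nf
    positivity

open Polynomial in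
lemma RR_eval (N x : ℝ) : (RR (C N) X : ℝ[X]).eval x = RR N x := by
  simp only [RR, r1, r0, d0, d1, d2, d3, h0, h1, e0, e1, e2, g0, g1, g2]
  simp

lemma RR_finite (N : ℝ) (hN : N = 2 ∨ 3 ≤ N) : {x : ℝ | RR N x = 0}.Finite := by
  have hne : (RR (Polynomial.C N) Polynomial.X : Polynomial ℝ) ≠ 0 := by
    intro h
    apply RR_half N hN
    rw [← RR_eval, h]; simp
  refine (Polynomial.finite_setOfPred_isRoot hne).subset ?_
  intro x hx
  simpa [Polynomial.IsRoot, RR_eval] using hx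

lemma planar (N : ℝ) (hN : N = 2 ∨ 3 ≤ N) (U : Set ℝ) (hU : IsOpen U)
    (hc : IsPreconnected U) (t₀ : ℝ) (ht₀ : t₀ ∈ U) (X Z k : ℝ → ℝ)
    (hX : ∀ t ∈ U, HasDerivAt X (k t * (X t * (-(h1 N (X t) * Z t + h0 N (X t)) / 6))) t)
    (hZ : ∀ t ∈ U, HasDerivAt Z (k t * (2 * Z t * (1 + Z t) * (X t - 1/2))) t)
    (hk : ∀ t ∈ U, k t ≠ 0) (hZp : ∀ t ∈ U, 0 < Z t)
    (hG : ∀ t ∈ U, g0 N (X t) + g1 N (X t) * Z t + g2 N (X t) * Z t ^ 2 = 0) : False := by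
  have hN2 : 2 ≤ N := by rcases hN with h | h <;> linarith
  have dconst : ∀ (f : ℝ → ℝ) (c f' : ℝ), (∀ t ∈ U, f t = c) → ∀ t ∈ U,
      HasDerivAt f f' t → f' = 0 := by
    intro f c f' hf t ht hd
    have : f =ᶠ[nhds t] fun _ => c := by
      filter_upwards [hU.mem_nhds ht] with s hs using hf s hs
    exact hd.unique ((hasDerivAt_const t c).congr_of_eventuallyEq this)
  have hR : ∀ t ∈ U, RR N (X t) = 0 := by
    intro t ht
    apply elim N (X t) (Z t) (hG t ht)
    have hx := hX t ht
    have hz := hZ t ht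
    set x' := k t * (X t * (-(h1 N (X t) * Z t + h0 N (X t)) / 6)) with hx'
    set z' := k t * (2 * Z t * (1 + Z t) * (X t - 1/2)) with hz'
    have D : HasDerivAt (fun t => g0 N (X t) + g1 N (X t) * Z t + g2 N (X t) * Z t ^ 2)
      ((2*X t*(28*N^2-24*N-36)+3*X t^2*(8*N^3-56*N^2+48*N)) * x'
        + ((102*N-198)+2*X t*(20*N^2-192*N+108)+3*X t^2*(-8*N^3-40*N^2+48*N)) * x' * Z t
        + g1 N (X t) * z'
        + ((-132*N+36)+2*X t*(-80*N^2+48*N)+3*X t^2*(-16*N^3+16*N^2)) * x' * Z t ^ 2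
        + g2 N (X t) * (2 * Z t * z')) t := by
      simp only [g0, g1, g2]
      have e1 := hx.pow 2
      have e2 := hx.pow 3
      have a0 := (e1.mul_const (28*N^2-24*N-36)).add (e2.mul_const (8*N^3-56*N^2+48*N))
      have a1 := (((hx.mul_const (102*N-198)).const_add 63).add
        (e1.mul_const (20*N^2-192*N+108))).add (e2.mul_const (-8*N^3-40*N^2+48*N))
      have a2 := (((hx.mul_const (-132*N+36)).const_add (-72)).add
        (e1.mul_const (-80*N^2+48*N))).add (e2.mul_const (-16*N^3+16*N^2))
      refine HasDerivAt.congr_deriv ((a0.add (a1.mul hz)).add (a2.mul (hz.pow 2))) ?_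
      simp
      ring
    have := dconst _ 0 _ hG t ht D
    have hkk := hk t ht
    have h6 : k t * (d0 N (X t) + d1 N (X t) * Z t + d2 N (X t) * Z t^2 + d3 N (X t) * Z t^3) = 0 := by
      have e : k t * (d0 N (X t) + d1 N (X t) * Z t + d2 N (X t) * Z t^2 + d3 N (X t) * Z t^3)
        = 6 * ((2*X t*(28*N^2-24*N-36)+3*X t^2*(8*N^3-56*N^2+48*N)) * x'
        + ((102*N-198)+2*X t*(20*N^2-192*N+108)+3*X t^2*(-8*N^3-40*N^2+48*N)) * x' * Z t
        + g1 N (X t) * z'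
        + ((-132*N+36)+2*X t*(-80*N^2+48*N)+3*X t^2*(-16*N^3+16*N^2)) * x' * Z t ^ 2
        + g2 N (X t) * (2 * Z t * z')) := by
        rw [hx', hz']
        simp only [d0, d1, d2, d3, e0, e1, e2]
        ring
      rw [e, this, mul_zero]
    exact (mul_eq_zero.mp h6).resolve_left hkk
  have hXc : ∀ t ∈ U, X t = X t₀ := by
    intro t ht
    have hcont : ContinuousOn X U := fun s hs => (hX s hs).continuousAt.continuousWithinAt
    have hpre := hc.image X hcont
    have hfin : (X '' U).Finite := (RR_finite N hN).subset (by
      rintro _ ⟨s, hs, rfl⟩; exact hR s hs)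
    have hsub : (X '' U).Subsingleton := by
      by_contra hns
      rw [Set.not_subsingleton_iff] at hns
      exact hpre.infinite_of_nontrivial hns hfin
    exact hsub ⟨t, ht, rfl⟩ ⟨t₀, ht₀, rfl⟩
  set x := X t₀ with hx
  have hX0 : ∀ t ∈ U, x * (h1 N x * Z t + h0 N x) = 0 := by
    intro t ht
    have := dconst X x _ hXc t ht (hX t ht)
    rw [hXc t ht] at this
    have := (mul_eq_zero.mp this).resolve_left (hk t ht)
    linear_combination (-6) * this
  have hZc : ∀ c, (∀ t ∈ U, Z t = c) → x = 1/2 := by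
    intro c h
    have := dconst Z c _ h t₀ ht₀ (hZ t₀ ht₀)
    have hz := hZp t₀ ht₀
    have := (mul_eq_zero.mp this).resolve_left (hk t₀ ht₀)
    have := (mul_eq_zero.mp this).resolve_left (by positivity)
    linarith
  by_cases hx0 : x = 0
  · have : ∀ t ∈ U, Z t = 7/8 := by
      intro t ht
      have := hG t ht
      rw [hXc t ht, hx0] at this
      simp only [g0, g1, g2] at this
      have h2 : Z t * (63 - 72 * Z t) = 0 := by linear_combination this
      have := (mul_eq_zero.mp h2).resolve_left (hZp t ht).ne'
      linarith
    have := hZc _ this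
    rw [hx0] at this
    norm_num at this
  · have hH : ∀ t ∈ U, h1 N x * Z t + h0 N x = 0 := fun t ht =>
      (mul_eq_zero.mp (hX0 t ht)).resolve_left hx0
    by_cases hh : h1 N x = 0
    · have h0' := hH t₀ ht₀
      rw [hh] at h0'
      simp only [h1] at hh
      simp only [h0] at h0'
      have h3 : 9 + 12 * N * x = 0 := by linear_combination hh - h0'
      have h4 : 15 * N + 9 = 0 := by
        linear_combination 4 * N * h0' - ((2*N-6)/3 + (N-1)/9*(12*N*x-9)) * h3
      linarith
    · have hx2 := hZc (- h0 N x / h1 N x) (by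
        intro t ht
        field_simp
        linear_combination hH t ht)
      have := hH t₀ ht₀
      rw [hx2] at this
      simp only [h1, h0] at this
      have hz := hZp t₀ ht₀
      nlinarith [mul_pos hz (by positivity : 0 < (N+3)^2), sq_nonneg N]

/-- Generic case: the closed system for `τ, φ, ψ`. -/
lemma generic (N : ℝ) (hN : N = 2 ∨ 3 ≤ N) (U : Set ℝ) (hU : IsOpen U)
    (hc : IsPreconnected U) (t₀ : ℝ) (ht₀ : t₀ ∈ U) (tau phi psi S : ℝ → ℝ)
    (hS : ∀ t ∈ U, 4 * (N - 1) * psi t * (N * psi t + 3 * tau t * phi t)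
        + (1 + (phi t) ^ 2) * (9 * (tau t) ^ 2 - 4 * S t) = 0)
    (h1 : ∀ t ∈ U, HasDerivAt tau ((2/3) * (tau t / 2 * (phi t * (3/2 * tau t) + N * psi t)
      + phi t * S t + psi t * (3/2 * tau t))) t)
    (h2 : ∀ t ∈ U, HasDerivAt phi (psi t * phi t - tau t / 2 * (1 + phi t ^ 2)) t)
    (h3 : ∀ t ∈ U, HasDerivAt psi (psi t ^ 2 - phi t * psi t * tau t / 2) t)
    (h4 : ∀ t ∈ U, -(deriv (deriv tau) t) + deriv tau t * (phi t * (3/2 * tau t) + N * psi t)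
        + tau t * (tau t ^ 2 / 4 + S t) = 0)
    (ht : ∀ t ∈ U, tau t ≠ 0) (hp : ∀ t ∈ U, phi t ≠ 0) : False := by
  have hm : ∀ t, 1 + phi t ^ 2 ≠ 0 := fun t => by positivity
  obtain ⟨u, hu⟩ : ∃ u : ℝ → ℝ, ∀ t, u t = psi t / (1 + phi t ^ 2) := ⟨_, fun _ => rfl⟩
  have hpsi : ∀ t, psi t = u t * (1 + phi t ^ 2) := fun t => by
    rw [hu]; field_simp [hm t]
  have hS' : ∀ t ∈ U, S t = 9/4 * tau t ^ 2
      + (N-1) * u t * (N * u t * (1 + phi t ^ 2) + 3 * tau t * phi t) := by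
    intro t h
    have := hS t h
    rw [hpsi t] at this
    apply mul_left_cancel₀ (hm t)
    linear_combination (-1/4) * this
  have du : ∀ t ∈ U, HasDerivAt u (u t * (u t * (1 - phi t ^ 2) + phi t * tau t / 2)) t := by
    intro t h
    have e := (h3 t h).div (((h2 t h).pow 2).const_add 1) (hm t)
    have e' : HasDerivAt u _ t := e.congr_of_eventuallyEq (Filter.Eventually.of_forall hu)
    refine e'.congr_deriv ?_
    rw [hu]
    have := hm t
    simp
    field_simp
    ring
  have dp : ∀ t ∈ U, HasDerivAt phi ((1 + phi t ^ 2) * (u t * phi t - tau t / 2)) t := by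
    intro t h
    refine (h2 t h).congr_deriv ?_
    rw [hpsi t]; ring
  obtain ⟨T, hT⟩ : ∃ T : ℝ → ℝ, ∀ t, T t = 2 * phi t * tau t ^ 2
      + (N+3)/3 * tau t * u t * (1 + phi t ^ 2)
      + 2/3*(N-1)*phi t * u t * (N * u t * (1 + phi t ^ 2) + 3 * tau t * phi t) :=
    ⟨_, fun _ => rfl⟩
  have dt : ∀ t ∈ U, HasDerivAt tau (T t) t := by
    intro t h
    refine (h1 t h).congr_deriv ?_
    rw [hpsi t, hS' t h, hT]; ring
  have dT : ∀ t ∈ U, deriv (deriv tau) t =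
      2 * ((1 + phi t ^ 2) * (u t * phi t - tau t / 2)) * tau t ^ 2 + 2 * phi t * (2 * tau t * T t)
      + (N+3)/3 * (T t * u t * (1 + phi t ^ 2)
        + tau t * (u t * (u t * (1 - phi t ^ 2) + phi t * tau t / 2)) * (1 + phi t ^ 2)
        + tau t * u t * (2 * phi t * ((1 + phi t ^ 2) * (u t * phi t - tau t / 2))))
      + 2/3*(N-1)*(((1 + phi t ^ 2) * (u t * phi t - tau t / 2)) * u t
          * (N * u t * (1 + phi t ^ 2) + 3 * tau t * phi t)
        + phi t * (u t * (u t * (1 - phi t ^ 2) + phi t * tau t / 2))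
          * (N * u t * (1 + phi t ^ 2) + 3 * tau t * phi t)
        + phi t * u t * (N * ((u t * (u t * (1 - phi t ^ 2) + phi t * tau t / 2)) * (1 + phi t ^ 2)
            + u t * (2 * phi t * ((1 + phi t ^ 2) * (u t * phi t - tau t / 2))))
          + 3 * (T t * phi t + tau t * ((1 + phi t ^ 2) * (u t * phi t - tau t / 2))))) := by
    intro t h
    have ev : deriv tau =ᶠ[nhds t] T := by
      filter_upwards [hU.mem_nhds h] with s hs using (dt s hs).deriv
    rw [ev.deriv_eq]
    have f := dp t h
    have v := du t h
    have a := dt t h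
    have m := (f.pow 2).const_add 1
    have w := ((v.const_mul N).mul m).add ((a.const_mul 3).mul f)
    have e := (((f.const_mul 2).mul (a.pow 2)).add (((a.const_mul ((N+3)/3)).mul v).mul m)).add
      (((f.const_mul (2/3*(N-1))).mul v).mul w)
    have e' : HasDerivAt T _ t := e.congr_of_eventuallyEq (Filter.Eventually.of_forall hT)
    rw [e'.deriv]
    simp
    ring
  refine planar N hN U hU hc t₀ ht₀ (fun t => u t * phi t / tau t) (fun t => phi t ^ 2)
    (fun t => tau t / phi t) ?_ ?_ ?_ ?_ ?_
  · intro t h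
    have e := ((du t h).mul (dp t h)).div (dt t h) (ht t h)
    refine e.congr_deriv ?_
    have a := ht t h
    have b := hp t h
    rw [hT]
    simp only [Biharm.h1, h0, Pi.mul_apply]
    field_simp
    ring
  · intro t h
    refine ((dp t h).pow 2).congr_deriv ?_
    have a := ht t h
    have b := hp t h
    simp
    field_simp
  · intro t h
    exact div_ne_zero (ht t h) (hp t h)
  · intro t h
    have b := hp t h
    show 0 < phi t ^ 2
    positivity
  · intro t h
    have a := ht t h
    have e := h4 t h
    rw [dT t h, (dt t h).deriv, hS' t h, hpsi t, hT] at e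
    simp only [g0, g1, g2]
    field_simp
    linear_combination 18 * phi t ^ 2 * e

/-- Umbilic case: all `λᵢ` coincide. -/
lemma umbilic (N : ℝ) (hN : N = 2 ∨ 3 ≤ N) (U : Set ℝ) (hU : IsOpen U)
    (t₀ : ℝ) (ht₀ : t₀ ∈ U) (tau m : ℝ → ℝ)
    (h1 : ∀ t ∈ U, HasDerivAt tau ((N+3)/3 * (tau t * m t)) t)
    (h2 : ∀ t ∈ U, HasDerivAt m (m t ^ 2 - 3 / (4 * N) * tau t ^ 2) t)
    (h3 : ∀ t ∈ U, -(deriv (deriv tau) t) + deriv tau t * (N * m t)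
        + tau t * (tau t ^ 2 / 4 + 9 / (4 * N) * tau t ^ 2) = 0)
    (ht : ∀ t ∈ U, tau t ≠ 0) : False := by
  have key : ∀ t ∈ U, m t ^ 2 * ((N+3)*(2*N-6)/9) + tau t ^ 2 * ((N+6)/(2*N)) = 0 := by
    intro t h
    have ev : deriv tau =ᶠ[nhds t] fun t => (N+3)/3 * (tau t * m t) := by
      filter_upwards [hU.mem_nhds h] with s hs using (h1 s hs).deriv
    have e := h3 t h
    have e2 : HasDerivAt (fun t => (N+3)/3 * (tau t * m t)) _ t :=
      ((h1 t h).mul (h2 t h)).const_mul ((N+3)/3)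
    rw [ev.deriv_eq, e2.deriv, (h1 t h).deriv] at e
    have hN0 : N ≠ 0 := by rcases hN with h | h <;> linarith
    apply mul_left_cancel₀ (ht t h)
    rw [← sub_eq_zero, mul_zero, sub_zero, ← e]
    field_simp
    ring
  rcases hN with rfl | h
  · have D := (((h2 t₀ ht₀).pow 2).mul_const (((2:ℝ)+3)*(2*2-6)/9)).add
      (((h1 t₀ ht₀).pow 2).mul_const (((2:ℝ)+6)/(2*2)))
    have ev : (fun t => m t ^ 2 * (((2:ℝ)+3)*(2*2-6)/9) + tau t ^ 2 * (((2:ℝ)+6)/(2*2)))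
        =ᶠ[nhds t₀] fun _ => 0 := by
      filter_upwards [hU.mem_nhds ht₀] with s hs using key s hs
    have z := D.unique ((hasDerivAt_const t₀ (0:ℝ)).congr_of_eventuallyEq ev)
    have k := key t₀ ht₀
    have a := ht t₀ ht₀
    simp at z
    have k' : m t₀ ^ 2 = 9/5 * tau t₀ ^ 2 := by linarith
    have hm : m t₀ * tau t₀ ^ 2 = 0 := by
      linear_combination (2/7 : ℝ) * z + (40/63) * m t₀ * k'
    have hm0 : m t₀ = 0 := (mul_eq_zero.mp hm).resolve_right (pow_ne_zero 2 a)
    rw [hm0] at k'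
    have : 0 < tau t₀ ^ 2 := by positivity
    linarith
  · have k := key t₀ ht₀
    have a := ht t₀ ht₀
    have : 0 < tau t₀ ^ 2 * ((N+6)/(2*N)) := by positivity
    have : 0 ≤ m t₀ ^ 2 * ((N+3)*(2*N-6)/9) := by
      apply mul_nonneg (sq_nonneg _)
      apply div_nonneg (mul_nonneg (by linarith) (by linarith)) (by norm_num)
    linarith

end Biharm

/-- Analytic core of the main theorem: a real-analytic solution of the ODE
system with `K = 0` admitting a linear relation `μᵢ = φλᵢ + ψ` and satisfying
the vanishing scalar curvature equation
`4(n₁-1)ψ(n₁ψ + 3τφ) + (1+φ²)(9τ² - 4Σλᵢ²) = 0` must have `τ ≡ 0`. -/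
theorem stmt_19 (n₁ : ℕ) (hn : 2 ≤ n₁) (K : ℝ) (hK : K = 0)
    (I : Set ℝ) (hI : IsOpen I) (hIconn : I.OrdConnected)
    (lam mu : Fin n₁ → ℝ → ℝ)
    (hlam : ∀ i, AnalyticOnNhd ℝ (lam i) I)
    (hmu : ∀ i, AnalyticOnNhd ℝ (mu i) I)
    (tau : ℝ → ℝ) (htau : ∀ t, tau t = (2/3) * ∑ i, lam i t)
    (hode1 : ∀ i, ∀ t ∈ I, HasDerivAt (lam i) ((tau t / 2 + lam i t) * mu i t) t)
    (hode2 : ∀ i, ∀ t ∈ I,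
      HasDerivAt (mu i) ((mu i t) ^ 2 - tau t / 2 * lam i t + K) t)
    (hode3 : ∀ t ∈ I,
      -(deriv (deriv tau) t) + deriv tau t * (∑ i, mu i t)
        + tau t * ((tau t) ^ 2 / 4 - ((n₁ : ℝ) + 1) * K + ∑ i, (lam i t) ^ 2) = 0)
    (phi psi : ℝ → ℝ)
    (hphi : AnalyticOnNhd ℝ phi I) (hpsi : AnalyticOnNhd ℝ psi I)
    (hlin : ∀ i, ∀ t ∈ I, mu i t = phi t * lam i t + psi t)
    (hscal : ∀ t ∈ I,
      4 * ((n₁ : ℝ) - 1) * psi t * ((n₁ : ℝ) * psi t + 3 * tau t * phi t)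
        + (1 + (phi t) ^ 2) * (9 * (tau t) ^ 2 - 4 * ∑ i, (lam i t) ^ 2) = 0) :
    ∀ t ∈ I, tau t = 0 := by
  subst hK
  have hNc : (n₁ : ℝ) = 2 ∨ 3 ≤ (n₁ : ℝ) := by
    rcases hn.eq_or_lt with h | h
    · left; rw [← h]; norm_num
    · right; exact_mod_cast h
  have hsum : ∀ t, ∑ i, lam i t = 3/2 * tau t := fun t => by rw [htau]; ring
  have htaud : ∀ t ∈ I, HasDerivAt tau
      ((2/3) * ∑ i, (tau t / 2 + lam i t) * mu i t) t := by
    intro t ht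
    have e := (HasDerivAt.fun_sum (u := Finset.univ) (fun i _ => hode1 i t ht)).const_mul (2/3 : ℝ)
    exact e.congr_of_eventuallyEq (Filter.Eventually.of_forall htau)
  have htauc : ∀ t ∈ I, ContinuousAt tau t := fun t ht => (htaud t ht).continuousAt
  by_contra hcon
  push Not at hcon
  obtain ⟨t₀, ht₀, hne⟩ := hcon
  by_cases hcase : ∃ t ∈ I, tau t ≠ 0 ∧ ∃ i j, lam i t ≠ lam j t
  · obtain ⟨t₁, ht₁, hne₁, i, j, hij⟩ := hcase
    have hV : ∀ᶠ t in nhds t₁, t ∈ I ∧ tau t ≠ 0 ∧ lam i t ≠ lam j t := by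
      refine Filter.Eventually.and (hI.mem_nhds ht₁) (((htauc t₁ ht₁).eventually_ne hne₁).and ?_)
      have c : ContinuousAt (fun t => lam i t - lam j t) t₁ :=
        (hode1 i t₁ ht₁).continuousAt.sub (hode1 j t₁ ht₁).continuousAt
      filter_upwards [c.eventually_ne (sub_ne_zero.mpr hij)] with s hs using sub_ne_zero.mp hs
    obtain ⟨V, hVs, hVo, hV₁⟩ := eventually_nhds_iff.mp hV |>.imp fun V h => h
    have hder : ∀ t ∈ V, deriv phi t = psi t * phi t - tau t / 2 * (1 + phi t ^ 2) ∧
        deriv psi t = psi t ^ 2 - phi t * psi t * tau t / 2 := by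
      intro t htV
      obtain ⟨htI, -, hd⟩ := hVs t htV
      have hp := (hphi t htI).differentiableAt.hasDerivAt
      have hs := (hpsi t htI).differentiableAt.hasDerivAt
      have E : ∀ l, (deriv phi t - (psi t * phi t - tau t / 2 * (1 + phi t ^ 2))) * lam l t
          + (deriv psi t - (psi t ^ 2 - phi t * psi t * tau t / 2)) = 0 := by
        intro l
        have e : HasDerivAt (mu l) _ t :=
          ((hp.mul (hode1 l t htI)).add hs).congr_of_eventuallyEq (by
            filter_upwards [hI.mem_nhds htI] with s hs using hlin l s hs)
        have := e.unique (hode2 l t htI)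
        rw [hlin l t htI] at this
        linear_combination this
      have h1 := E i
      have h2 := E j
      have h3 : deriv phi t - (psi t * phi t - tau t / 2 * (1 + phi t ^ 2)) = 0 := by
        have : (deriv phi t - (psi t * phi t - tau t / 2 * (1 + phi t ^ 2)))
          * (lam i t - lam j t) = 0 := by linear_combination h1 - h2
        exact (mul_eq_zero.mp this).resolve_right (sub_ne_zero.mpr hd)
      rw [h3] at h1
      exact ⟨by linarith, by linarith⟩
    have hphid : ∀ t ∈ V, HasDerivAt phi (psi t * phi t - tau t / 2 * (1 + phi t ^ 2)) t := by
      intro t h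
      rw [← (hder t h).1]
      exact (hphi t (hVs t h).1).differentiableAt.hasDerivAt
    have hpsid : ∀ t ∈ V, HasDerivAt psi (psi t ^ 2 - phi t * psi t * tau t / 2) t := by
      intro t h
      rw [← (hder t h).2]
      exact (hpsi t (hVs t h).1).differentiableAt.hasDerivAt
    obtain ⟨t₂, ht₂, hphi₂⟩ : ∃ t ∈ V, phi t ≠ 0 := by
      by_contra hall
      push Not at hall
      have ev : phi =ᶠ[nhds t₁] fun _ => 0 := by
        filter_upwards [hVo.mem_nhds hV₁] with s hs using hall s hs
      have := (hphid t₁ hV₁).unique ((hasDerivAt_const t₁ (0:ℝ)).congr_of_eventuallyEq ev)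
      rw [hall t₁ hV₁] at this
      apply hne₁
      linarith
    have hW : ∀ᶠ t in nhds t₂, t ∈ V ∧ phi t ≠ 0 :=
      Filter.Eventually.and (hVo.mem_nhds ht₂) ((hphid t₂ ht₂).continuousAt.eventually_ne hphi₂)
    obtain ⟨ε, hε, hball⟩ := Metric.eventually_nhds_iff_ball.mp hW
    have hpre : IsPreconnected (Metric.ball t₂ ε) := (convex_ball t₂ ε).isPreconnected
    have hmus : ∀ t ∈ I, ∑ l, mu l t = phi t * (3/2 * tau t) + n₁ * psi t := by
      intro t ht
      rw [Finset.sum_congr rfl (fun l _ => hlin l t ht), Finset.sum_add_distrib,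
        ← Finset.mul_sum, hsum]
      simp
    refine Biharm.generic n₁ hNc (Metric.ball t₂ ε) Metric.isOpen_ball hpre t₂
      (Metric.mem_ball_self hε) tau phi psi (fun t => ∑ l, lam l t ^ 2) ?_ ?_ ?_ ?_ ?_ ?_ ?_
    · intro t h
      exact hscal t (hVs t (hball t h).1).1
    · intro t h
      have htI := (hVs t (hball t h).1).1
      refine (htaud t htI).congr_deriv ?_
      congr 1
      have : ∀ l ∈ Finset.univ, (tau t / 2 + lam l t) * mu l t =
          tau t / 2 * mu l t + (phi t * lam l t ^ 2 + psi t * lam l t) := by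
        intro l _
        rw [hlin l t htI]; ring
      rw [Finset.sum_congr rfl this, Finset.sum_add_distrib, Finset.sum_add_distrib,
        ← Finset.mul_sum, ← Finset.mul_sum, ← Finset.mul_sum, hmus t htI, hsum]
      ring
    · exact fun t h => hphid t (hball t h).1
    · exact fun t h => hpsid t (hball t h).1
    · intro t h
      have htI := (hVs t (hball t h).1).1
      have := hode3 t htI
      rw [hmus t htI] at this
      linear_combination this
    · exact fun t h => (hVs t (hball t h).1).2.1
    · exact fun t h => (hball t h).2
  · push Not at hcase
    have hW : ∀ᶠ t in nhds t₀, t ∈ I ∧ tau t ≠ 0 :=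
      Filter.Eventually.and (hI.mem_nhds ht₀) ((htauc t₀ ht₀).eventually_ne hne)
    obtain ⟨ε, hε, hball⟩ := Metric.eventually_nhds_iff_ball.mp hW
    have hN0 : (n₁ : ℝ) ≠ 0 := by rcases hNc with h | h <;> linarith
    let i₀ : Fin n₁ := ⟨0, by omega⟩
    have hl : ∀ t ∈ Metric.ball t₀ ε, ∀ l, lam l t = 3 / (2 * n₁) * tau t := by
      intro t h l
      have h1 := hsum t
      rw [Finset.sum_congr rfl (fun j _ => hcase t (hball t h).1 (hball t h).2 j l)] at h1
      simp at h1
      field_simp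
      linear_combination 2 * h1
    have hm : ∀ t ∈ Metric.ball t₀ ε, ∀ l, mu l t = mu i₀ t := by
      intro t h l
      rw [hlin l t (hball t h).1, hlin i₀ t (hball t h).1, hl t h l, hl t h i₀]
    refine Biharm.umbilic n₁ hNc (Metric.ball t₀ ε) Metric.isOpen_ball t₀
      (Metric.mem_ball_self hε) tau (mu i₀) ?_ ?_ ?_ ?_
    · intro t h
      refine (htaud t (hball t h).1).congr_deriv ?_
      rw [Finset.sum_congr rfl (fun l _ => by rw [hm t h l, hl t h l])]
      simp
      field_simp
    · intro t h
      refine (hode2 i₀ t (hball t h).1).congr_deriv ?_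
      rw [hl t h i₀]
      field_simp
      ring
    · intro t h
      have := hode3 t (hball t h).1
      have s1 : ∑ l, mu l t = n₁ * mu i₀ t := by
        rw [Finset.sum_congr rfl (fun l _ => hm t h l)]; simp
      have s2 : ∑ l, lam l t ^ 2 = n₁ * (3 / (2 * n₁) * tau t) ^ 2 := by
        rw [Finset.sum_congr rfl (fun l _ => congrArg (· ^ 2) (hl t h l))]; simp
      rw [s1, s2] at this
      rw [← this]
      field_simp
      ring
    · exact fun t h => (hball t h).2
end
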